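/- arXiv:0807.2137 — 2 statements merged into one kernel-verified Lean document; each statement's English description precedes it below -/
import Mathlib

section
/- For every 3-dimensional polytope P in ℝ³ there exist polynomials p₀, p₁, p₂ ∈ ℝ[x₁,x₂,x₃] such that: the function associated to p₀ is strictly concave on ℝ³ and p₀ vanishes at every vertex of P; p₂(x) = ∏_{F facet of P} q_F(P,x); and P = {x ∈ ℝ³ : p₀(x) ≥ 0, p₁(x) ≥ 0 and p₂(x) ≥ 0}. -/
open scoped RealInnerProductSpace Pointwise
open Metric Set

noncomputable section

/-- Euclidean space ℝ^d. -/
abbrev E (d : ℕ) : Type := EuclideanSpace ℝ (Fin d)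

/-- Evaluation of a multivariate polynomial at a point of ℝ^d. -/
def evalPoly {d : ℕ} (p : MvPolynomial (Fin d) ℝ) (x : E d) : ℝ :=
  MvPolynomial.eval (fun i => x i) p

/-- A polytope: the convex hull of a (nonempty) finite point set. -/
def IsPolytope {d : ℕ} (P : Set (E d)) : Prop :=
  ∃ V : Finset (E d), V.Nonempty ∧ P = convexHull ℝ (V : Set (E d))

/-- A polyhedron: a nonempty intersection of finitely many closed halfspaces. -/
def IsPolyhedron {d : ℕ} (P : Set (E d)) : Prop :=
  P.Nonempty ∧ ∃ (m : ℕ) (a : Fin m → E d) (b : Fin m → ℝ),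
    P = {x : E d | ∀ i, ⟪a i, x⟫ ≤ b i}

/-- Dimension of a set: the dimension of its affine hull. -/
def dimS {d : ℕ} (A : Set (E d)) : ℕ :=
  Module.finrank ℝ (affineSpan ℝ A).direction

/-- Faces of a polytope (= exposed subsets). -/
def IsFaceOf {d : ℕ} (P F : Set (E d)) : Prop := IsExposed ℝ P F

/-- A facet of an n-dimensional polytope: an (n−1)-dimensional face. -/
def IsFacetOf {d : ℕ} (P F : Set (E d)) : Prop :=
  IsExposed ℝ P F ∧ dimS F + 1 = dimS P

/-- A vertex: a 0-dimensional face. -/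
def IsVertexOf {d : ℕ} (P : Set (E d)) (v : E d) : Prop := IsExposed ℝ P {v}

/-- Support function h(P,u). -/
def suppF {d : ℕ} (P : Set (E d)) (u : E d) : ℝ := sSup ((fun x => ⟪u, x⟫) '' P)

/-- Exposed face F(P,u) of P in direction u. -/
def exposedSet {d : ℕ} (P : Set (E d)) (u : E d) : Set (E d) :=
  {x ∈ P | ⟪u, x⟫ = suppF P u}

/-- The unit outer normal u_F(P) of a facet G of P, parallel to aff P. -/
def outerNormal {d : ℕ} (P G : Set (E d)) : E d :=
  Classical.epsilon fun u : E d =>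
    u ∈ (affineSpan ℝ P).direction ∧ ‖u‖ = 1 ∧ exposedSet P u = G

/-- q_G(P,x) := (h(P,u_G(P)) − ⟨u_G(P),x⟩)/diam(P). -/
def qF {d : ℕ} (P G : Set (E d)) (x : E d) : ℝ :=
  (suppF P (outerNormal P G) - ⟪outerNormal P G, x⟫) / Metric.diam P

/-- Conical hull: all nonnegative combinations of points of A. -/
def coneHull {d : ℕ} (A : Set (E d)) : Set (E d) :=
  {x | ∃ (n : ℕ) (c : Fin n → ℝ) (p : Fin n → E d),
    (∀ i, 0 ≤ c i) ∧ (∀ i, p i ∈ A) ∧ x = ∑ i, c i • p i}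

/-- Supporting cone S(P,v) := cone (P − v). -/
def suppCone {d : ℕ} (P : Set (E d)) (v : E d) : Set (E d) :=
  coneHull ((fun x => x - v) '' P)

/-- F⁻(P,x): the facets of P visible from x. -/
def visFacets {d : ℕ} (P : Set (E d)) (x : E d) : Set (Set (E d)) :=
  {G | IsFacetOf P G ∧ qF P G x ≤ 0}

/-- The facets of P containing the set A. -/
def facetsCont {d : ℕ} (P A : Set (E d)) : Set (Set (E d)) :=
  {G | IsFacetOf P G ∧ A ⊆ G}

/-- u_G(P): the normalized sum of the outer facet normals over facets containing G. -/
def uface {d : ℕ} (P G : Set (E d)) : E d :=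
  ‖∑ᶠ F ∈ facetsCont P G, outerNormal P F‖⁻¹ • ∑ᶠ F ∈ facetsCont P G, outerNormal P F

/-- The hyperplane H_v(P) := {x : ⟨x, u_v(P)⟩ = −1}. -/
def Hv {d : ℕ} (P : Set (E d)) (v : E d) : Set (E d) :=
  {x : E d | ⟪x, uface P {v}⟫ = -1}

/-- P_v := S(P,v) ∩ H_v(P). -/
def vertFig {d : ℕ} (P : Set (E d)) (v : E d) : Set (E d) :=
  suppCone P v ∩ Hv P v

/-- S_ρ(P,v) := cone((P_v + B(o,ρ)) ∩ H_v(P)). -/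
def Srho {d : ℕ} (P : Set (E d)) (v : E d) (ρ : ℝ) : Set (E d) :=
  coneHull ((vertFig P v + Metric.closedBall (0 : E d) ρ) ∩ Hv P v)

/-- Condition 𝒜(P): Hausdorff distance between P and {x ∈ aff P : g_l(x) ≥ 0} tends to 0. -/
def condA {d : ℕ} (P : Set (E d)) (g : ℕ → MvPolynomial (Fin d) ℝ) : Prop :=
  Filter.Tendsto
    (fun l => Metric.hausdorffDist P
      {x ∈ (affineSpan ℝ P : Set (E d)) | 0 ≤ evalPoly (g l) x})
    Filter.atTop (nhds 0)

/-- Condition ℐ(P): each g_l vanishes on all vertices of P. -/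
def condI {d : ℕ} (P : Set (E d)) (g : ℕ → MvPolynomial (Fin d) ℝ) : Prop :=
  ∀ (l : ℕ) (v : E d), IsVertexOf P v → evalPoly (g l) v = 0

/-- Condition 𝒞(P): each g_l is strictly concave on aff P. -/
def condC {d : ℕ} (P : Set (E d)) (g : ℕ → MvPolynomial (Fin d) ℝ) : Prop :=
  ∀ l : ℕ, StrictConcaveOn ℝ (affineSpan ℝ P : Set (E d)) (evalPoly (g l))

open Filter Topology in
lemma aux_tangent (l : ℕ) (s t : ℝ) :
    s ^ (2 * (l + 1)) + (2 * (l + 1) : ℝ) * s ^ (2 * l + 1) * (t - s) ≤ t ^ (2 * (l + 1)) := by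
  have hc : ConvexOn ℝ Set.univ (fun x : ℝ => x ^ (2 * (l + 1))) :=
    Even.convexOn_pow (even_two_mul _)
  have hd : HasDerivAt (fun x : ℝ => x ^ (2 * (l + 1))) ((2 * (l + 1) : ℝ) * s ^ (2 * l + 1)) s := by
    have := hasDerivAt_pow (2 * (l + 1)) s
    convert! this using 2
    push_cast; ring
  rcases lt_trichotomy s t with h | h | h
  · have := hc.le_slope_of_hasDerivAt (mem_univ s) (mem_univ t) h hd
    rw [slope_def_field, le_div_iff₀ (by linarith)] at this
    linarith
  · subst h; simp
  · have := hc.slope_le_of_hasDerivAt (mem_univ t) (mem_univ s) h hd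
    rw [slope_def_field, div_le_iff₀ (by linarith)] at this
    linarith

open Filter Topology in
lemma aux_pow_tendsto (c : ℝ) (hc : |c| < 1) (k : ℕ) :
    Tendsto (fun l : ℕ => |c| ^ (2 * l + k)) atTop (𝓝 0) := by
  have h1 : Tendsto (fun l : ℕ => 2 * l + k) atTop atTop :=
    tendsto_atTop_mono (fun l => by simp only [id]; omega) tendsto_id
  exact (tendsto_pow_atTop_nhds_zero_of_lt_one (abs_nonneg c) hc).comp h1

open scoped Matrix in
open Filter Topology in
lemma aux_numeric {J K : Type*} [Fintype J] [Fintype K] [DecidableEq J]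
    (A : J → J → ℝ) (B : J → K → ℝ) (hA1 : ∀ j, A j j = 1)
    (hA : ∀ j k, j ≠ k → |A j k| < 1) (hB : ∀ j F, |B j F| < 1) (M : ℝ) (hM : 0 ≤ M) :
    ∃ (l : ℕ) (c : J → ℝ), (∀ k, 0 < c k) ∧
      (∀ j, ∑ k, c k * A j k ^ (2 * (l + 1)) + ∑ F, B j F ^ (2 * (l + 1)) = 1) ∧
      ∀ j (s : J → ℝ) (t : K → ℝ), 1 ≤ s j → (∀ k, |s k - A j k| ≤ M * (s j - 1)) →
        (∀ F, |t F - B j F| ≤ M * (s j - 1)) →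
        1 - ∑ k, c k * s k ^ (2 * (l + 1)) - ∑ F, t F ^ (2 * (l + 1)) ≤ -(1/2) * (s j - 1) := by
  have habs : ∀ (x : ℝ) (l : ℕ), x ^ (2 * (l + 1)) = |x| ^ (2 * l + 2) := fun x l => by
    rw [show 2 * l + 2 = 2 * (l + 1) by ring]; exact (Even.pow_abs (even_two_mul _) x).symm
  set Mt : ℕ → Matrix J J ℝ := fun l => Matrix.of fun j k => A j k ^ (2 * (l + 1)) with hMt
  set r : ℕ → J → ℝ := fun l j => 1 - ∑ F, B j F ^ (2 * (l + 1)) with hr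
  have hMt1 : Tendsto Mt atTop (𝓝 1) := by
    refine tendsto_pi_nhds.2 fun j => tendsto_pi_nhds.2 fun k => ?_
    by_cases hjk : j = k
    · subst hjk; simp [hMt, hA1]
    · simp only [hMt, Matrix.of_apply, Matrix.one_apply_ne hjk, habs]
      exact aux_pow_tendsto _ (hA j k hjk) 2
  have hr1 : Tendsto r atTop (𝓝 (fun _ => 1)) := by
    rw [tendsto_pi_nhds]; intro j
    have : Tendsto (fun l => 1 - ∑ F, B j F ^ (2 * (l + 1))) atTop (𝓝 (1 - ∑ F : K, 0)) := by
      refine tendsto_const_nhds.sub (tendsto_finsetSum _ fun F _ => ?_)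
      simp only [habs]
      exact aux_pow_tendsto _ (hB j F) 2
    simpa [hr] using this
  have hdet : Tendsto (fun l => (Mt l).det) atTop (𝓝 1) := by
    have : Continuous (fun X : Matrix J J ℝ => X.det) := Continuous.matrix_det continuous_id
    simpa [Function.comp_def] using (this.tendsto 1).comp hMt1
  have hadj : Tendsto (fun l => (Mt l).adjugate) atTop (𝓝 1) := by
    have : Continuous (fun X : Matrix J J ℝ => X.adjugate) := Continuous.matrix_adjugate continuous_id
    simpa [Function.comp_def] using (this.tendsto 1).comp hMt1
  set c : ℕ → J → ℝ := fun l => ((Mt l).det)⁻¹ • ((Mt l).adjugate *ᵥ r l) with hc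
  have hc1 : Tendsto c atTop (𝓝 (fun _ => 1)) := by
    have h2 : Continuous (fun p : Matrix J J ℝ × (J → ℝ) => p.1 *ᵥ p.2) :=
      Continuous.matrix_mulVec continuous_fst continuous_snd
    have h3 := (h2.tendsto (1, fun _ => 1)).comp (hadj.prodMk_nhds hr1)
    have h4 := (hdet.inv₀ one_ne_zero).smul h3
    simpa [hc, Function.comp_def] using h4
  have hMc : ∀ᶠ l in atTop, Mt l *ᵥ c l = r l := by
    filter_upwards [hdet.eventually_ne one_ne_zero] with l hl
    simp only [hc, Matrix.mulVec_smul, Matrix.mulVec_mulVec, Matrix.mul_adjugate,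
      Matrix.smul_mulVec, Matrix.one_mulVec]
    rw [smul_smul, inv_mul_cancel₀ hl, one_smul]
  have hcj : ∀ᶠ l in atTop, ∀ j, 1/2 < c l j := by
    rw [eventually_all]; intro j
    exact ((tendsto_pi_nhds.1 hc1) j).eventually_const_lt (by norm_num)
  set Er : ℕ → J → ℝ := fun l j => ∑ k ∈ Finset.univ.erase j, |c l k| * |A j k| ^ (2 * l + 1)
     + ∑ F, |B j F| ^ (2 * l + 1) with hEr
  have hE : ∀ᶠ l in atTop, ∀ j, M * Er l j < 1/4 := by
    rw [eventually_all]; intro j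
    have : Tendsto (fun l => M * Er l j) atTop (𝓝 (M * (∑ k ∈ Finset.univ.erase j, |(1:ℝ)| * 0 + ∑ F : K, 0))) := by
      refine tendsto_const_nhds.mul (Tendsto.add (tendsto_finsetSum _ fun k hk => ?_) (tendsto_finsetSum _ fun F _ => ?_))
      · exact ((tendsto_pi_nhds.1 hc1) k).abs.mul
          (aux_pow_tendsto _ (hA j k (Finset.ne_of_mem_erase hk).symm) 1)
      · exact aux_pow_tendsto _ (hB j F) 1
    exact this.eventually_lt_const (by simp)
  obtain ⟨l, h1, h2, h3⟩ := (hMc.and (hcj.and hE)).exists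
  have key : ∀ j, ∑ k, c l k * A j k ^ (2 * (l + 1)) + ∑ F, B j F ^ (2 * (l + 1)) = 1 := by
    intro j
    have := congrFun h1 j
    simp only [Matrix.mulVec, dotProduct, hMt, hr, Matrix.of_apply] at this
    have e : ∑ k, c l k * A j k ^ (2 * (l + 1)) = ∑ k, A j k ^ (2 * (l + 1)) * c l k :=
      Finset.sum_congr rfl fun _ _ => mul_comm _ _
    rw [e, this]; ring
  refine ⟨l, c l, fun k => by linarith [h2 k], key, ?_⟩
  intro j s t hsj hs ht
  have hL : (0:ℝ) ≤ l := Nat.cast_nonneg l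
  set δ := s j - 1 with hδ
  have hδ0 : 0 ≤ δ := by linarith
  have e1 : ∀ k ∈ Finset.univ.erase j, c l k * A j k ^ (2 * (l + 1)) - (2 * (l + 1) : ℝ) * (M * δ) * (|c l k| * |A j k| ^ (2 * l + 1))
      ≤ c l k * s k ^ (2 * (l + 1)) := by
    intro k _
    have h := aux_tangent l (A j k) (s k)
    have hck : 0 < c l k := by linarith [h2 k]
    rw [abs_of_pos hck]
    have h5 : -(M * δ * |A j k| ^ (2 * l + 1)) ≤ A j k ^ (2 * l + 1) * (s k - A j k) := by
      have : |A j k ^ (2 * l + 1) * (s k - A j k)| ≤ |A j k| ^ (2 * l + 1) * (M * δ) := by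
        rw [abs_mul, abs_pow]
        exact mul_le_mul_of_nonneg_left (hs k) (by positivity)
      have := neg_abs_le (A j k ^ (2 * l + 1) * (s k - A j k))
      linarith
    have h6 : A j k ^ (2 * (l + 1)) - (2 * (l + 1) : ℝ) * (M * δ * |A j k| ^ (2 * l + 1)) ≤ s k ^ (2 * (l + 1)) := by
      have := mul_le_mul_of_nonneg_left h5 (show (0:ℝ) ≤ 2 * (l + 1) by positivity)
      linarith
    have := mul_le_mul_of_nonneg_left h6 hck.le
    linarith
  have e2 : ∀ F ∈ (Finset.univ : Finset K), B j F ^ (2 * (l + 1)) - (2 * (l + 1) : ℝ) * (M * δ) * |B j F| ^ (2 * l + 1)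
      ≤ t F ^ (2 * (l + 1)) := by
    intro F _
    have h := aux_tangent l (B j F) (t F)
    have h5 : -(M * δ * |B j F| ^ (2 * l + 1)) ≤ B j F ^ (2 * l + 1) * (t F - B j F) := by
      have : |B j F ^ (2 * l + 1) * (t F - B j F)| ≤ |B j F| ^ (2 * l + 1) * (M * δ) := by
        rw [abs_mul, abs_pow]
        exact mul_le_mul_of_nonneg_left (ht F) (by positivity)
      have := neg_abs_le (B j F ^ (2 * l + 1) * (t F - B j F))
      linarith
    have := mul_le_mul_of_nonneg_left h5 (show (0:ℝ) ≤ 2 * (l + 1) by positivity)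
    linarith
  have s1 := Finset.sum_le_sum e1
  have s2 := Finset.sum_le_sum e2
  rw [Finset.sum_sub_distrib, ← Finset.mul_sum] at s1 s2
  have hj := aux_tangent l 1 (s j)
  rw [one_pow, one_pow] at hj
  have k1 := key j
  rw [← Finset.add_sum_erase _ _ (Finset.mem_univ j), hA1, one_pow] at k1
  rw [← Finset.add_sum_erase _ (fun k => c l k * s k ^ (2 * (l + 1))) (Finset.mem_univ j)]
  have hj2 := mul_le_mul_of_nonneg_left hj (show 0 ≤ c l j by linarith [h2 j])
  have hEj := h3 j
  simp only [hEr] at hEj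
  set S1 := ∑ k ∈ Finset.univ.erase j, |c l k| * |A j k| ^ (2 * l + 1)
  set S2 := ∑ F, |B j F| ^ (2 * l + 1)
  have hcl := h2 j
  have f1 : (2 * (l + 1) : ℝ) * δ * (c l j - M * (S1 + S2)) ≥ (2 * (l + 1) : ℝ) * δ * (1/4) := by
    apply mul_le_mul_of_nonneg_left _ (by positivity); linarith
  have f2 : (2 * (l + 1) : ℝ) * δ * (1/4) ≥ 1/2 * δ := by nlinarith
  have : s j - 1 = δ := rfl
  rw [this] at hj2
  nlinarith

def IsPF (f : E 3 → ℝ) : Prop := ∃ p : MvPolynomial (Fin 3) ℝ, ∀ x, evalPoly p x = f x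

lemma IsPF.const (c : ℝ) : IsPF (fun _ => c) := ⟨MvPolynomial.C c, fun x => by simp [evalPoly]⟩
lemma IsPF.add {f g : E 3 → ℝ} (hf : IsPF f) (hg : IsPF g) : IsPF (fun x => f x + g x) := by
  obtain ⟨p, hp⟩ := hf; obtain ⟨q, hq⟩ := hg
  exact ⟨p + q, fun x => by simp only [← hp, ← hq]; simp [evalPoly]⟩
lemma IsPF.sub {f g : E 3 → ℝ} (hf : IsPF f) (hg : IsPF g) : IsPF (fun x => f x - g x) := by
  obtain ⟨p, hp⟩ := hf; obtain ⟨q, hq⟩ := hg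
  exact ⟨p - q, fun x => by simp only [← hp, ← hq]; simp [evalPoly]⟩
lemma IsPF.mul {f g : E 3 → ℝ} (hf : IsPF f) (hg : IsPF g) : IsPF (fun x => f x * g x) := by
  obtain ⟨p, hp⟩ := hf; obtain ⟨q, hq⟩ := hg
  exact ⟨p * q, fun x => by simp only [← hp, ← hq]; simp [evalPoly]⟩
lemma IsPF.pow {f : E 3 → ℝ} (hf : IsPF f) (n : ℕ) : IsPF (fun x => f x ^ n) := by
  obtain ⟨p, hp⟩ := hf
  exact ⟨p ^ n, fun x => by simp only [← hp]; simp [evalPoly]⟩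
lemma IsPF.sum {κ : Type*} (s : Finset κ) {f : κ → E 3 → ℝ} (hf : ∀ i, IsPF (f i)) :
    IsPF (fun x => ∑ i ∈ s, f i x) := by
  choose p hp using hf
  exact ⟨∑ i ∈ s, p i, fun x => by simp [evalPoly, ← hp]⟩
lemma IsPF.prod {κ : Type*} (s : Finset κ) {f : κ → E 3 → ℝ} (hf : ∀ i, IsPF (f i)) :
    IsPF (fun x => ∏ i ∈ s, f i x) := by
  choose p hp using hf
  exact ⟨∏ i ∈ s, p i, fun x => by simp [evalPoly, ← hp]⟩
lemma IsPF.inner (a : E 3) : IsPF (fun x => ⟪a, x⟫) := by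
  refine ⟨∑ i, MvPolynomial.C (a i) * MvPolynomial.X i, fun x => ?_⟩
  simp [evalPoly, PiLp.inner_apply, mul_comm]
lemma IsPF.innerSub (a v : E 3) : IsPF (fun x => ⟪a, x - v⟫) := by
  have := (IsPF.inner a).sub (IsPF.const ⟪a, v⟫)
  simpa only [← inner_sub_right] using this

/-- local sign lemma -/
lemma aux_loc {ι : Type*} [Fintype ι] [DecidableEq ι] (a : ι → ℝ) (b : ι → ℝ)
    (hpos : ∀ i, a i ≠ 0 → 0 < b i) (hprod : 0 ≤ ∏ i, b i) (hneg : ∃ i, b i < 0) :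
    ∃ i j, i ≠ j ∧ a i = 0 ∧ a j = 0 ∧ b i < 0 ∧ b j ≤ 0 := by
  obtain ⟨i, hi⟩ := hneg
  have hai : a i = 0 := by by_contra h; linarith [hpos i h]
  by_cases h : ∃ j, j ≠ i ∧ b j ≤ 0
  · obtain ⟨j, hj, hbj⟩ := h
    refine ⟨i, j, hj.symm, hai, ?_, hi, hbj⟩
    by_contra h; linarith [hpos j h]
  · push Not at h
    exfalso
    rw [← Finset.mul_prod_erase _ _ (Finset.mem_univ i)] at hprod
    have : 0 < ∏ x ∈ Finset.univ.erase i, b x :=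
      Finset.prod_pos fun j hj => h j (Finset.ne_of_mem_erase hj)
    nlinarith

/-- abstract polytope data: `q i x = b i + ⟪l i, x⟫`. -/
structure PD (m : ℕ) (V : Finset (E 3)) (l : Fin m → E 3) (b : Fin m → ℝ) (n : E 3 → E 3) :
    Prop where
  hV : V.Nonempty
  hP : ∀ x, x ∈ convexHull ℝ (V : Set (E 3)) ↔ ∀ i, 0 ≤ b i + ⟪l i, x⟫
  hc : ∃ c, ∀ i, 0 < b i + ⟪l i, c⟫
  ind : ∀ i j z d y, i ≠ j → z ∈ convexHull ℝ (V : Set (E 3)) → b i + ⟪l i, z⟫ = 0 →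
    b j + ⟪l j, z⟫ = 0 → d ≠ 0 → ⟪l i, d⟫ = 0 → ⟪l j, d⟫ = 0 → ⟪l i, y⟫ = 0 → ⟪l j, y⟫ = 0 →
    ∃ t : ℝ, y = t • d
  irr : ∀ i j k z s, i ≠ j → i ≠ k → j ≠ k → z ∈ convexHull ℝ (V : Set (E 3)) →
    b i + ⟪l i, z⟫ = 0 → b j + ⟪l j, z⟫ = 0 → b k + ⟪l k, z⟫ = 0 → s ≠ 0 →
    ⟪l i, s⟫ = 0 → ⟪l j, s⟫ = 0 → ⟪l k, s⟫ = 0 → False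
  hn : ∀ v ∈ V, ∀ w ∈ V, w ≠ v → 0 < ⟪n v, w - v⟫ ∧ ⟪n v, w - v⟫ ≤ 1

namespace PD
variable {m : ℕ} {V : Finset (E 3)} {l : Fin m → E 3} {b : Fin m → ℝ} {n : E 3 → E 3}

/-- tangent cone at v -/
def Cone (l : Fin m → E 3) (b : Fin m → ℝ) (v y : E 3) : Prop :=
  ∀ i, b i + ⟪l i, v⟫ = 0 → 0 ≤ ⟪l i, y⟫

lemma q_sub (i : Fin m) (v x : E 3) : b i + ⟪l i, x⟫ = b i + ⟪l i, v⟫ + ⟪l i, x - v⟫ := by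
  rw [inner_sub_right]; ring

lemma mem (h : PD m V l b n) {v : E 3} (hv : v ∈ V) : v ∈ convexHull ℝ (V : Set (E 3)) :=
  subset_convexHull ℝ _ hv

lemma pos_of_mem (h : PD m V l b n) {v x : E 3} (hv : v ∈ V)
    (hx : x ∈ convexHull ℝ (V : Set (E 3))) (hne : x ≠ v) : 0 < ⟪n v, x - v⟫ := by
  have hc : Convex ℝ {x : E 3 | x = v ∨ 0 < ⟪n v, x - v⟫} := by
    rw [convex_iff_forall_pos]
    intro x hx y hy s t hs ht hst
    have e : s • x + t • y - v = s • (x - v) + t • (y - v) := by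
      have : v = (s + t) • v := by rw [hst, one_smul]
      nth_rewrite 1 [this]; module
    simp only [mem_ofPred_eq, e, inner_add_right, inner_smul_right] at *
    rcases hx with rfl | hx <;> rcases hy with rfl | hy
    · left; rw [← add_smul, hst, one_smul]
    · right; simp; positivity
    · right; simp; positivity
    · right; positivity
  have hsub := convexHull_min (s := (V : Set (E 3))) (t := {x : E 3 | x = v ∨ 0 < ⟪n v, x - v⟫})
    (fun w hw => by
      by_cases hwv : w = v
      · exact Or.inl hwv
      · exact Or.inr (h.hn v hv w hw hwv).1) hc
  exact (hsub hx).resolve_left hne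

lemma cone_small (h : PD m V l b n) {v y : E 3} (hv : v ∈ V) (hy : Cone l b v y) :
    ∃ t : ℝ, 0 < t ∧ v + t • y ∈ convexHull ℝ (V : Set (E 3)) := by
  have hvP := (h.hP v).1 (h.mem hv)
  have : ∀ᶠ t : ℝ in nhdsWithin 0 (Ioi 0), ∀ i, 0 ≤ b i + ⟪l i, v + t • y⟫ := by
    rw [Filter.eventually_all]; intro i
    by_cases hi : b i + ⟪l i, v⟫ = 0
    · filter_upwards [self_mem_nhdsWithin] with t ht
      have ht : 0 < t := ht
      rw [inner_add_right, inner_smul_right, ← add_assoc, hi, zero_add]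
      exact mul_nonneg ht.le (hy i hi)
    · have hc : Filter.Tendsto (fun t : ℝ => b i + ⟪l i, v + t • y⟫) (nhds 0)
          (nhds (b i + ⟪l i, v + (0:ℝ) • y⟫)) := by
        apply Continuous.tendsto (f := fun t : ℝ => b i + ⟪l i, v + t • y⟫); fun_prop
      have h0 : 0 < b i + ⟪l i, v + (0:ℝ) • y⟫ := by
        rw [zero_smul, add_zero]; exact lt_of_le_of_ne (hvP i) (Ne.symm hi)
      filter_upwards [(hc.mono_left nhdsWithin_le_nhds).eventually_const_lt h0] with t ht using ht.le
  obtain ⟨t, ht, ht0⟩ := (this.and self_mem_nhdsWithin).exists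
  exact ⟨t, ht0, (h.hP _).2 ht⟩

lemma cone_pos (h : PD m V l b n) {v y : E 3} (hv : v ∈ V) (hy : Cone l b v y) (hy0 : y ≠ 0) :
    0 < ⟪n v, y⟫ := by
  obtain ⟨t, ht, hm⟩ := h.cone_small hv hy
  have := h.pos_of_mem hv hm (by
    intro e
    have : t • y = 0 := by simpa using e
    rcases smul_eq_zero.1 this with h | h
    · linarith
    · exact hy0 h)
  rw [add_sub_cancel_left, inner_smul_right] at this
  exact (pos_iff_pos_of_mul_pos this).1 ht

lemma cone_of_mem (h : PD m V l b n) {v x : E 3} (hx : x ∈ convexHull ℝ (V : Set (E 3))) :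
    Cone l b v (x - v) := by
  intro i hi
  have := (h.hP x).1 hx i
  rw [q_sub i v x, hi, zero_add] at this
  exact this

lemma sep (h : PD m V l b n) {s : E 3} (hs : s ≠ 0) : ∃ i, ⟪l i, s⟫ ≠ 0 := by
  by_contra hcon
  push Not at hcon
  obtain ⟨v, hv⟩ := h.hV
  have h1 := h.cone_pos hv (y := s) (fun i _ => (hcon i).ge) hs
  have h2 := h.cone_pos hv (y := -s) (fun i _ => by rw [inner_neg_right, hcon i]; simp) (by simpa using hs)
  rw [inner_neg_right] at h2
  linarith

lemma exists_facet_not (h : PD m V l b n) {u v : E 3} (hu : u ∈ V) (hv : v ∈ V) (huv : u ≠ v) :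
    ∃ i, b i + ⟪l i, v⟫ = 0 ∧ b i + ⟪l i, u⟫ ≠ 0 := by
  by_contra hcon
  push Not at hcon
  have h0 : ∀ i, b i + ⟪l i, v⟫ = 0 → ⟪l i, u - v⟫ = 0 := by
    intro i hi
    have := hcon i hi
    rw [q_sub i v u, hi, zero_add] at this
    exact this
  have hne : u - v ≠ 0 := sub_ne_zero.2 huv
  have h1 := h.cone_pos hv (y := u - v) (fun i hi => (h0 i hi).ge) hne
  have h2 := h.cone_pos hv (y := -(u - v)) (fun i hi => by rw [inner_neg_right, h0 i hi]; simp) (neg_ne_zero.2 hne)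
  rw [inner_neg_right] at h2
  linarith

/-- points almost satisfying the inequalities are close to P -/
lemma near (h : PD m V l b n) : ∃ (c : E 3) (D : ℝ), 0 < D ∧ ∀ (η : ℝ) (x : E 3), 0 < η →
    (∀ i, -η ≤ b i + ⟪l i, x⟫) → ∃ t : ℝ, t = D / (D + η) ∧
      c + t • (x - c) ∈ convexHull ℝ (V : Set (E 3)) := by
  obtain ⟨c, hc⟩ := h.hc
  have : ∃ D : ℝ, 0 < D ∧ ∀ i, D ≤ b i + ⟪l i, c⟫ := by
    rcases isEmpty_or_nonempty (Fin m) with he | he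
    · exact ⟨1, one_pos, fun i => (he.false i).elim⟩
    · obtain ⟨i0, hi0⟩ := Finite.exists_min (fun i => b i + ⟪l i, c⟫)
      exact ⟨_, hc i0, hi0⟩
  obtain ⟨D, hD, hDi⟩ := this
  refine ⟨c, D, hD, fun η x hη hx => ⟨_, rfl, ?_⟩⟩
  rw [h.hP]
  intro i
  rw [q_sub i c, add_sub_cancel_left, inner_smul_right]
  have h1 : -η ≤ b i + ⟪l i, c⟫ + ⟪l i, x - c⟫ := by rw [← q_sub]; exact hx i
  have h2 := hDi i
  rw [show b i + ⟪l i, c⟫ + D / (D + η) * ⟪l i, x - c⟫ =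
    ((b i + ⟪l i, c⟫) * (D + η) + D * ⟪l i, x - c⟫) / (D + η) by field_simp]
  apply div_nonneg _ (by positivity)
  nlinarith
end PD

lemma pow_conv_le (k : ℕ) (s t a b : ℝ) (ha : 0 ≤ a) (hb : 0 ≤ b) (hab : a + b = 1) :
    (a * s + b * t) ^ (2 * (k + 1)) ≤ a * s ^ (2 * (k + 1)) + b * t ^ (2 * (k + 1)) := by
  have := (Even.convexOn_pow (𝕜 := ℝ) (even_two_mul (k+1))).2 (mem_univ s) (mem_univ t) ha hb hab
  simpa using this

lemma pow_conv_lt (k : ℕ) (s t a b : ℝ) (hst : s ≠ t) (ha : 0 < a) (hb : 0 < b) (hab : a + b = 1) :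
    (a * s + b * t) ^ (2 * (k + 1)) < a * s ^ (2 * (k + 1)) + b * t ^ (2 * (k + 1)) := by
  have := (Even.strictConvexOn_pow (even_two_mul (k+1)) (by omega)).2 (mem_univ s) (mem_univ t) hst ha hb hab
  simpa using this

lemma exists_scale {κ : Type*} [Finite κ] (g : κ → ℝ) : ∃ ε : ℝ, 0 < ε ∧ ∀ i, ε * g i ≤ 1 := by
  obtain ⟨M, hM⟩ := (Set.finite_range g).bddAbove
  refine ⟨1 / (|M| + 1), by positivity, fun i => ?_⟩
  have := hM (mem_range_self i)
  rw [div_mul_eq_mul_div, one_mul, div_le_one (by positivity)]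
  linarith [le_abs_self M]

namespace PD
variable {m : ℕ} {V : Finset (E 3)} {l : Fin m → E 3} {b : Fin m → ℝ} {n : E 3 → E 3}

lemma lemA (h : PD m V l b n) (η : ℝ) (hη : 0 < η) :
    ∃ p : E 3 → ℝ, IsPF p ∧ StrictConcaveOn ℝ univ p ∧ (∀ v ∈ V, p v = 0) ∧
      (∀ x ∈ convexHull ℝ (V : Set (E 3)), 0 ≤ p x) ∧
      ∀ x, 0 ≤ p x → (∀ i, -η ≤ b i + ⟪l i, x⟫) ∧ ∀ v ∈ V, -η * ‖x - v‖ ≤ ⟪n v, x - v⟫ := by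
  classical
  obtain ⟨ε, hε, hεb⟩ := exists_scale (fun p : {v // v ∈ V} × Fin m => b p.2 + ⟪l p.2, (p.1 : E 3)⟫)
  set η' := min (1/2) (ε * η) with hη'
  have hη'0 : 0 < η' := lt_min (by norm_num) (by positivity)
  have hη'1 : η' ≤ 1/2 := min_le_left _ _
  have hη'2 : η' ≤ ε * η := min_le_right _ _
  set hh : {v // v ∈ V} → E 3 → ℝ := fun w x => 1 - ⟪n w, x - w⟫ with hhh
  set gg : Fin m → E 3 → ℝ := fun F x => 1 - η' - ε * (b F + ⟪l F, x⟫) with hgg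
  set M : ℝ := (∑ w : {v // v ∈ V}, ‖n w‖ + ∑ F, ε * ‖l F‖) / η with hM
  have hM0 : 0 ≤ M := by positivity
  have hMn : ∀ w : {v // v ∈ V}, ‖n w‖ ≤ M * η := by
    intro w
    rw [hM, div_mul_cancel₀ _ hη.ne']
    have := Finset.single_le_sum (f := fun w : {v // v ∈ V} => ‖n w‖) (fun _ _ => norm_nonneg _) (Finset.mem_univ w)
    have h2 : 0 ≤ ∑ F, ε * ‖l F‖ := by positivity
    linarith
  have hMl : ∀ F, ε * ‖l F‖ ≤ M * η := by
    intro w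
    rw [hM, div_mul_cancel₀ _ hη.ne']
    have := Finset.single_le_sum (f := fun w => ε * ‖l w‖) (fun _ _ => by positivity) (Finset.mem_univ w)
    have h2 : 0 ≤ ∑ w : {v // v ∈ V}, ‖n w‖ := by positivity
    linarith
  obtain ⟨k, c, hc, hsum, htan⟩ := aux_numeric (fun v w : {v // v ∈ V} => hh w v)
    (fun (v : {v // v ∈ V}) F => gg F v) (fun j => by simp [hhh])
    (fun v w hvw => by
      have := h.hn w w.2 v v.2 (fun e => hvw (Subtype.ext e))
      simp only [hhh]
      rw [abs_lt]; constructor <;> linarith)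
    (fun v F => by
      have h1 := (h.hP v).1 (h.mem v.2) F
      have h2 := hεb (v, F)
      have h3 : 0 ≤ ε * (b F + ⟪l F, (v : E 3)⟫) := by positivity
      simp only [hgg] at *
      rw [abs_lt]; constructor <;> linarith) M hM0
  have haffh : ∀ w x y (s t : ℝ), s + t = 1 → hh w (s • x + t • y) = s * hh w x + t * hh w y := by
    intro w x y s t hst
    simp only [hhh, inner_sub_right, inner_add_right, inner_smul_right]
    obtain rfl : t = 1 - s := by linarith
    ring
  have haffg : ∀ w x y (s t : ℝ), s + t = 1 → gg w (s • x + t • y) = s * gg w x + t * gg w y := by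
    intro w x y s t hst
    simp only [hgg, inner_add_right, inner_smul_right]
    obtain rfl : t = 1 - s := by linarith
    ring
  set p : E 3 → ℝ := fun x => 1 - ∑ w, c w * hh w x ^ (2 * (k + 1)) - ∑ F, gg F x ^ (2 * (k + 1)) with hp
  have hzero : ∀ v ∈ V, p v = 0 := fun v hv => by
    have := hsum ⟨v, hv⟩
    simp only [hp]; linarith
  have hconc : StrictConcaveOn ℝ univ p := by
    refine ⟨convex_univ, fun x _ y _ hxy s t hs ht hst => ?_⟩
    obtain ⟨F0, hF0⟩ := h.sep (sub_ne_zero.2 hxy)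
    have h1 : ∑ w, c w * hh w (s • x + t • y) ^ (2 * (k + 1)) ≤
        ∑ w, (s * (c w * hh w x ^ (2 * (k + 1))) + t * (c w * hh w y ^ (2 * (k + 1)))) := by
      refine Finset.sum_le_sum fun w _ => ?_
      rw [haffh w x y s t hst]
      have := mul_le_mul_of_nonneg_left (pow_conv_le k (hh w x) (hh w y) s t hs.le ht.le hst) (hc w).le
      linarith
    have h2 : ∑ F, gg F (s • x + t • y) ^ (2 * (k + 1)) <
        ∑ F, (s * gg F x ^ (2 * (k + 1)) + t * gg F y ^ (2 * (k + 1))) := by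
      refine Finset.sum_lt_sum (fun F _ => ?_) ⟨F0, Finset.mem_univ _, ?_⟩
      · rw [haffg F x y s t hst]
        exact pow_conv_le k _ _ s t hs.le ht.le hst
      · rw [haffg F0 x y s t hst]
        refine pow_conv_lt k _ _ s t ?_ hs ht hst
        intro e
        apply hF0
        simp only [hgg] at e
        rw [inner_sub_right]
        have : ε * (⟪l F0, x⟫ - ⟪l F0, y⟫) = 0 := by linarith
        exact (mul_eq_zero.1 this).resolve_left hε.ne'
    rw [Finset.sum_add_distrib, ← Finset.mul_sum, ← Finset.mul_sum] at h1 h2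
    simp only [hp, smul_eq_mul]
    obtain rfl : t = 1 - s := by linarith
    linarith
  refine ⟨p, ?_, hconc, hzero, ?_, ?_⟩
  · refine ((IsPF.const 1).sub (IsPF.sum _ fun w => (IsPF.const _).mul (IsPF.pow ?_ _))).sub
      (IsPF.sum _ fun F => IsPF.pow ?_ _)
    · exact (IsPF.const 1).sub (IsPF.innerSub _ _)
    · exact (IsPF.const _).sub ((IsPF.const _).mul ((IsPF.const _).add (IsPF.inner _)))
  · intro x hx
    have hcv : Convex ℝ {x | x ∈ univ ∧ 0 ≤ p x} := hconc.concaveOn.convex_ge 0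
    have := convexHull_min (s := (V : Set (E 3))) (t := {x | x ∈ univ ∧ 0 ≤ p x})
      (fun v hv => ⟨mem_univ v, (hzero v hv).ge⟩) hcv hx
    exact this.2
  · intro x hx
    refine ⟨fun i => ?_, fun v hv => ?_⟩
    · have h1 : 0 ≤ ∑ w, c w * hh w x ^ (2 * (k + 1)) := Finset.sum_nonneg fun w _ =>
        mul_nonneg (hc w).le (Even.pow_nonneg (even_two_mul _) _)
      have h2 := Finset.single_le_sum (f := fun F => gg F x ^ (2 * (k + 1)))
        (fun F _ => Even.pow_nonneg (even_two_mul _) _) (Finset.mem_univ i)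
      have h3 : gg i x ^ (2 * (k + 1)) ≤ 1 := by
        simp only [hp] at hx; linarith
      have h4 : gg i x ≤ 1 := by
        by_contra hcon
        push Not at hcon
        have := one_lt_pow₀ hcon (show 2 * (k + 1) ≠ 0 by omega)
        linarith
      simp only [hgg] at h4
      have : ε * (-η) ≤ ε * (b i + ⟪l i, x⟫) := by linarith
      exact le_of_mul_le_mul_left this hε
    · by_contra hcon
      push Not at hcon
      have hb : η * ‖x - v‖ ≤ hh ⟨v, hv⟩ x - 1 := by simp only [hhh]; linarith
      have hpos : 0 < hh ⟨v, hv⟩ x - 1 := by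
        have : 0 ≤ η * ‖x - v‖ := by positivity
        simp only [hhh]; linarith
      have := htan ⟨v, hv⟩ (fun w => hh w x) (fun F => gg F x) (by linarith)
        (fun w => by
          have e : hh w x - hh w v = - ⟪n w, x - v⟫ := by
            simp only [hhh, inner_sub_right]; ring
          have h1 := abs_real_inner_le_norm (n w) (x - v)
          have h2 := mul_le_mul_of_nonneg_right (hMn w) (norm_nonneg (x - v))
          have h3 := mul_le_mul_of_nonneg_left hb hM0
          simp only [e, abs_neg]
          linarith)
        (fun w => by
          have e : gg w x - gg w v = - (ε * ⟪l w, x - v⟫) := by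
            simp only [hgg, inner_sub_right]; ring
          have h1 := mul_le_mul_of_nonneg_left (abs_real_inner_le_norm (l w) (x - v)) hε.le
          have h2 := mul_le_mul_of_nonneg_right (hMl w) (norm_nonneg (x - v))
          have h3 := mul_le_mul_of_nonneg_left hb hM0
          simp only [e, abs_neg, abs_mul, abs_of_pos hε]
          linarith)
      simp only [hp] at hx
      linarith
end PD

open Filter Topology in
lemma ultra_lim {K : Set (E 3)} (hK : IsCompact K) (x : ℕ → E 3) (hx : ∀ n, x n ∈ K) :
    ∃ z ∈ K, Tendsto x (hyperfilter ℕ : Filter ℕ) (𝓝 z) := by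
  obtain ⟨z, hz, h⟩ := hK.ultrafilter_le_nhds ((hyperfilter ℕ).map x) (by
    rw [le_principal_iff]
    exact Filter.mem_map.2 (Filter.univ_mem' hx))
  exact ⟨z, hz, h⟩

open Filter Topology in
lemma hyper_inv : Tendsto (fun N : ℕ => (1 : ℝ) / (N + 1)) (hyperfilter ℕ : Filter ℕ) (𝓝 0) := by
  refine tendsto_one_div_add_atTop_nhds_zero_nat.mono_left ?_
  rw [← Nat.cofinite_eq_atTop]
  exact hyperfilter_le_cofinite

namespace PD
variable {m : ℕ} {V : Finset (E 3)} {l : Fin m → E 3} {b : Fin m → ℝ} {n : E 3 → E 3}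

open Filter Topology in
lemma near_cone (h : PD m V l b n) (v : E 3) :
    ∃ η : ℝ, 0 < η ∧ ∀ y, 0 < ⟪n v, y⟫ → (∀ i, b i + ⟪l i, v⟫ = 0 → -η * ⟪n v, y⟫ ≤ ⟪l i, y⟫) →
      ¬ Cone l b v y → 0 ≤ ∏ i : {i // b i + ⟪l i, v⟫ = 0}, ⟪l i, y⟫ →
      ∃ i j d, i ≠ j ∧ b i + ⟪l i, v⟫ = 0 ∧ b j + ⟪l j, v⟫ = 0 ∧ d ≠ 0 ∧ Cone l b v d ∧
        ⟪l i, d⟫ = 0 ∧ ⟪l j, d⟫ = 0 ∧ ⟪l i, y⟫ < 0 ∧ ⟪l j, y⟫ ≤ 0 := by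
  classical
  by_contra hcon
  push Not at hcon
  have hN : ∀ N : ℕ, (0:ℝ) < 1 / (N + 1) := fun N => by positivity
  choose y hy1 hy2 hy3 hy4 hy5 using fun N : ℕ => hcon (1 / (N + 1)) (hN N)
  have hy0 : ∀ N, 0 < ‖y N‖ := by
    intro N; rw [norm_pos_iff]; rintro e
    have := hy1 N; rw [e, inner_zero_right] at this; exact lt_irrefl _ this
  obtain ⟨d, hd, hlim⟩ := ultra_lim (isCompact_sphere (0 : E 3) 1) (fun N => ‖y N‖⁻¹ • y N)
    (fun N => by
      simp only [mem_sphere_zero_iff_norm, norm_smul, norm_inv, norm_norm]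
      exact inv_mul_cancel₀ (hy0 N).ne')
  have hd0 : d ≠ 0 := by
    rintro rfl; simp at hd
  have hin : ∀ a : E 3, Tendsto (fun N => ⟪a, ‖y N‖⁻¹ • y N⟫) (hyperfilter ℕ : Filter ℕ) (𝓝 ⟪a, d⟫) :=
    fun a => tendsto_const_nhds.inner hlim
  have hcone : Cone l b v d := by
    intro i hi
    have h1 : Tendsto (fun N : ℕ => -((1:ℝ) / (N + 1)) * ⟪n v, ‖y N‖⁻¹ • y N⟫) (hyperfilter ℕ : Filter ℕ) (𝓝 (-0 * ⟪n v, d⟫)) :=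
      hyper_inv.neg.mul (hin _)
    rw [neg_zero, zero_mul] at h1
    refine le_of_tendsto_of_tendsto' h1 (hin (l i)) fun N => ?_
    have := mul_le_mul_of_nonneg_left (hy2 N i hi) (inv_nonneg.2 (hy0 N).le)
    rw [inner_smul_right, inner_smul_right]
    linarith
  have hev : ∀ᶠ N in (hyperfilter ℕ : Filter ℕ), ∀ i : {i // b i + ⟪l i, v⟫ = 0}, ⟪l i, d⟫ ≠ 0 → 0 < ⟪l i, y N⟫ := by
    rw [eventually_all]; intro i
    by_cases hi : ⟪l i, d⟫ = 0
    · simp [hi]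
    · have : 0 < ⟪l i, d⟫ := lt_of_le_of_ne (hcone i i.2) (Ne.symm hi)
      filter_upwards [(hin (l i)).eventually_const_lt this] with N hN _
      rw [inner_smul_right] at hN
      exact (pos_iff_pos_of_mul_pos hN).1 (inv_pos.2 (hy0 N))
  obtain ⟨N, hN⟩ := hev.exists
  obtain ⟨i, j, hij, hi, hj, hi', hj'⟩ := aux_loc (fun i : {i // b i + ⟪l i, v⟫ = 0} => ⟪l i, d⟫)
    (fun i => ⟪l i, y N⟫) hN (hy4 N) (by
      have := hy3 N
      simp only [Cone] at this
      push Not at this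
      obtain ⟨i, hi, hi'⟩ := this
      exact ⟨⟨i, hi⟩, hi'⟩)
  exact absurd hj' (not_le.2 (hy5 N i j d (fun e => hij (Subtype.ext e)) i.2 j.2 hd0 hcone hi hj hi'))

/-- rays -/
def Rays (l : Fin m → E 3) (b : Fin m → ℝ) (n : E 3 → E 3) (v : E 3) : Set (E 3) :=
  {y | ⟪n v, y⟫ = 1 ∧ Cone l b v y ∧ ∃ i j, i ≠ j ∧ b i + ⟪l i, v⟫ = 0 ∧ b j + ⟪l j, v⟫ = 0 ∧
    ⟪l i, y⟫ = 0 ∧ ⟪l j, y⟫ = 0}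

lemma ne_zero_of_inner_one {a y : E 3} (h : ⟪a, y⟫ = 1) : y ≠ 0 := by
  rintro rfl; simp at h

lemma ray_unique (h : PD m V l b n) {v : E 3} (hv : v ∈ V) {i j : Fin m} {x y : E 3} (hij : i ≠ j)
    (hi : b i + ⟪l i, v⟫ = 0) (hj : b j + ⟪l j, v⟫ = 0) (hx : ⟪n v, x⟫ = 1) (hy : ⟪n v, y⟫ = 1)
    (hix : ⟪l i, x⟫ = 0) (hjx : ⟪l j, x⟫ = 0) (hiy : ⟪l i, y⟫ = 0) (hjy : ⟪l j, y⟫ = 0) : x = y := by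
  obtain ⟨t, ht⟩ := h.ind i j v y x hij (h.mem hv) hi hj (ne_zero_of_inner_one hy) hiy hjy hix hjx
  rw [ht, inner_smul_right, hy] at hx
  rw [ht, show t = 1 by linarith, one_smul]

lemma rays_finite (h : PD m V l b n) {v : E 3} (hv : v ∈ V) : (Rays l b n v).Finite := by
  have : Rays l b n v ⊆ ⋃ p : Fin m × Fin m, {y | ⟪n v, y⟫ = 1 ∧ p.1 ≠ p.2 ∧
      b p.1 + ⟪l p.1, v⟫ = 0 ∧ b p.2 + ⟪l p.2, v⟫ = 0 ∧ ⟪l p.1, y⟫ = 0 ∧ ⟪l p.2, y⟫ = 0} := by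
    rintro y ⟨h1, -, i, j, h2⟩
    exact mem_iUnion.2 ⟨(i, j), h1, h2⟩
  refine (Set.finite_iUnion fun p => Set.Subsingleton.finite ?_).subset this
  rintro x ⟨hx, hne, h1, h2, h3, h4⟩ y ⟨hy, -, -, -, h5, h6⟩
  exact h.ray_unique hv hne h1 h2 hx hy h3 h4 h5 h6

open Filter Topology in
lemma cone_bound (h : PD m V l b n) {v : E 3} (hv : v ∈ V) :
    ∃ κ : ℝ, 0 < κ ∧ ∀ y, Cone l b v y → κ * ‖y‖ ≤ ⟪n v, y⟫ := by
  by_contra hcon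
  push Not at hcon
  have hN : ∀ N : ℕ, (0:ℝ) < 1 / (N + 1) := fun N => by positivity
  choose y hy1 hy2 using fun N : ℕ => hcon (1 / (N + 1)) (hN N)
  have hy0 : ∀ N, 0 < ‖y N‖ := by
    intro N; rw [norm_pos_iff]; rintro e
    have := hy2 N; rw [e] at this; simp at this
  obtain ⟨d, hd, hlim⟩ := ultra_lim (isCompact_sphere (0 : E 3) 1) (fun N => ‖y N‖⁻¹ • y N)
    (fun N => by
      simp only [mem_sphere_zero_iff_norm, norm_smul, norm_inv, norm_norm]
      exact inv_mul_cancel₀ (hy0 N).ne')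
  have hd0 : d ≠ 0 := by
    rintro rfl; simp at hd
  have hin : ∀ a : E 3, Tendsto (fun N => ⟪a, ‖y N‖⁻¹ • y N⟫) (hyperfilter ℕ : Filter ℕ) (𝓝 ⟪a, d⟫) :=
    fun a => tendsto_const_nhds.inner hlim
  have hcone : Cone l b v d := by
    intro i hi
    refine ge_of_tendsto' (hin (l i)) fun N => ?_
    rw [inner_smul_right]
    exact mul_nonneg (inv_nonneg.2 (hy0 N).le) (hy1 N i hi)
  have h1 := h.cone_pos hv hcone hd0
  have h2 : ⟪n v, d⟫ ≤ 0 := by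
    refine le_of_tendsto_of_tendsto' (hin (n v)) hyper_inv fun N => ?_
    rw [inner_smul_right, inv_mul_le_iff₀ (hy0 N), mul_comm]
    exact (hy2 N).le
  linarith

/-- the section of the tangent cone is the convex hull of the rays -/
lemma section_hull (h : PD m V l b n) {v : E 3} (hv : v ∈ V) {y : E 3} (hy : ⟪n v, y⟫ = 1)
    (hc : Cone l b v y) : y ∈ convexHull ℝ (Rays l b n v) := by
  classical
  set Q : Set (E 3) := {y | ⟪n v, y⟫ = 1 ∧ Cone l b v y} with hQ
  obtain ⟨κ, hκ, hκb⟩ := h.cone_bound hv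
  have hclosed : IsClosed Q := by
    have : Q = {y | ⟪n v, y⟫ = 1} ∩ ⋂ i, ⋂ (_ : b i + ⟪l i, v⟫ = 0), {y | 0 ≤ ⟪l i, y⟫} := by
      ext y; simp [hQ, Cone]
    rw [this]
    refine (isClosed_eq (by fun_prop) continuous_const).inter (isClosed_iInter fun i => isClosed_iInter fun _ => ?_)
    exact isClosed_le continuous_const (by fun_prop)
  have hbdd : Bornology.IsBounded Q := by
    refine (Metric.isBounded_closedBall (x := (0 : E 3)) (r := 1 / κ)).subset ?_
    rintro y ⟨h1, h2⟩
    have := hκb y h2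
    rw [mem_closedBall_zero_iff, le_div_iff₀ hκ]
    linarith
  have hcomp : IsCompact Q := Metric.isCompact_of_isClosed_isBounded hclosed hbdd
  have hconv : Convex ℝ Q := by
    intro x hx y hy s t hs ht hst
    refine ⟨?_, fun i hi => ?_⟩
    · rw [inner_add_right, inner_smul_right, inner_smul_right, hx.1, hy.1]; linarith
    · rw [inner_add_right, inner_smul_right, inner_smul_right]
      exact add_nonneg (mul_nonneg hs (hx.2 i hi)) (mul_nonneg ht (hy.2 i hi))
  have hext : Q.extremePoints ℝ ⊆ Rays l b n v := by
    intro y hyext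
    have hyQ := hyext.1
    refine ⟨hyQ.1, hyQ.2, ?_⟩
    by_contra hcon
    push Not at hcon
    -- a direction s with ⟪n v, s⟫ = 0, killing the only active facet
    have : ∃ a : E 3, ∀ i, b i + ⟪l i, v⟫ = 0 → ⟪l i, y⟫ = 0 → ∀ s, ⟪a, s⟫ = 0 → ⟪l i, s⟫ = 0 := by
      by_cases hact : ∃ i, b i + ⟪l i, v⟫ = 0 ∧ ⟪l i, y⟫ = 0
      · obtain ⟨i0, hi0, hi0'⟩ := hact
        refine ⟨l i0, fun i hi hi' s hs => ?_⟩
        by_cases e : i = i0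
        · rw [e]; exact hs
        · exact absurd hi0' (hcon i i0 e hi hi0 hi')
      · push Not at hact
        exact ⟨0, fun i hi hi' => absurd hi' (hact i hi)⟩
    obtain ⟨a, ha⟩ := this
    have : ∃ s : E 3, s ≠ 0 ∧ ⟪n v, s⟫ = 0 ∧ ⟪a, s⟫ = 0 := by
      let T : E 3 →ₗ[ℝ] (Fin 2 → ℝ) := LinearMap.pi ![(innerSL ℝ (n v)).toLinearMap, (innerSL ℝ a).toLinearMap]
      have hker : 0 < Module.finrank ℝ (LinearMap.ker T) := by
        have h1 := LinearMap.finrank_range_add_finrank_ker T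
        have h2 := Submodule.finrank_le (LinearMap.range T)
        simp at h1 h2
        omega
      obtain ⟨⟨s, hs⟩, hs0⟩ := Module.finrank_pos_iff_exists_ne_zero.1 hker
      refine ⟨s, fun e => hs0 (Subtype.ext e), ?_, ?_⟩
      · have := congrFun (LinearMap.mem_ker.1 hs) 0
        simpa [T] using this
      · have := congrFun (LinearMap.mem_ker.1 hs) 1
        simpa [T] using this
    obtain ⟨s, hs0, hs1, hs2⟩ := this
    have hev : ∀ᶠ t : ℝ in nhds 0, ∀ i, b i + ⟪l i, v⟫ = 0 → 0 ≤ ⟪l i, y + t • s⟫ := by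
      rw [Filter.eventually_all]; intro i
      by_cases hi : b i + ⟪l i, v⟫ = 0
      · by_cases hi' : ⟪l i, y⟫ = 0
        · filter_upwards with t _
          rw [inner_add_right, inner_smul_right, hi', ha i hi hi' s hs2]; simp
        · have hc : Filter.Tendsto (fun t : ℝ => ⟪l i, y + t • s⟫) (nhds 0)
              (nhds (⟪l i, y + (0:ℝ) • s⟫)) := by
            apply Continuous.tendsto (f := fun t : ℝ => ⟪l i, y + t • s⟫); fun_prop
          have h0 : 0 < ⟪l i, y + (0:ℝ) • s⟫ := by
            rw [zero_smul, add_zero]; exact lt_of_le_of_ne (hyQ.2 i hi) (Ne.symm hi')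
          filter_upwards [hc.eventually_const_lt h0] with t ht _ using ht.le
      · simp [hi]
    obtain ⟨r, hr, hball⟩ := Metric.eventually_nhds_iff.1 hev
    have hmem : ∀ t : ℝ, |t| < r → y + t • s ∈ Q := fun t ht =>
      ⟨by rw [inner_add_right, inner_smul_right, hs1, hyQ.1]; ring,
       fun i hi => hball (by simpa using ht) i hi⟩
    have hr2 : |r / 2| < r := by rw [abs_of_pos (by linarith)]; linarith
    have hr3 : |-(r / 2)| < r := by rw [abs_neg]; exact hr2
    have := hyext.2 (hmem _ hr2) (hmem _ hr3) (by
      refine ⟨1/2, 1/2, by norm_num, by norm_num, by norm_num, ?_⟩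
      module)
    have : (r / 2) • s = 0 := by simpa using this
    rcases smul_eq_zero.1 this with h | h
    · linarith
    · exact hs0 h
  have hkm := closure_convexHull_extremePoints hcomp hconv
  have hyQ : y ∈ closure (convexHull ℝ (Q.extremePoints ℝ)) := by rw [hkm]; exact ⟨hy, hc⟩
  have hfin := h.rays_finite hv
  have hcl : IsClosed (convexHull ℝ (Rays l b n v)) :=
    hfin.isClosed_convexHull ℝ
  exact (closure_minimal (convexHull_mono hext) hcl) hyQ
end PD

lemma three_bound (a1 a2 a3 : E 3) (h0 : ∀ y, ⟪a1, y⟫ = 0 → ⟪a2, y⟫ = 0 → ⟪a3, y⟫ = 0 → y = 0) :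
    ∃ C : ℝ, 0 ≤ C ∧ ∀ y, ⟪a1, y⟫ = 0 → ‖y‖ ≤ C * (|⟪a2, y⟫| + |⟪a3, y⟫|) := by
  let T : E 3 →ₗ[ℝ] (Fin 3 → ℝ) := LinearMap.pi ![(innerSL ℝ a1).toLinearMap,
    (innerSL ℝ a2).toLinearMap, (innerSL ℝ a3).toLinearMap]
  have hT : ∀ y, T y = ![⟪a1, y⟫, ⟪a2, y⟫, ⟪a3, y⟫] := by
    intro y; ext i; fin_cases i <;> simp [T]
  have hker : LinearMap.ker T = ⊥ := by
    rw [LinearMap.ker_eq_bot']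
    intro y hy
    rw [hT] at hy
    exact h0 y (by simpa using congrFun hy 0) (by simpa using congrFun hy 1) (by simpa using congrFun hy 2)
  obtain ⟨K, hK, hal⟩ := T.exists_antilipschitzWith hker
  refine ⟨K, K.2, fun y hy => ?_⟩
  have := hal.le_mul_dist y 0
  rw [dist_zero_right, map_zero, dist_zero_right] at this
  refine this.trans (mul_le_mul_of_nonneg_left ?_ K.2)
  rw [pi_norm_le_iff_of_nonneg (by positivity), hT]
  intro i; fin_cases i
  · simp [hy]; positivity
  · simp
  · simp

namespace PD
variable {m : ℕ} {V : Finset (E 3)} {l : Fin m → E 3} {b : Fin m → ℝ} {n : E 3 → E 3}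

lemma lemB (h : PD m V l b n) {v : E 3} (hv : v ∈ V) :
    ∃ (k : ℕ) (f : E 3 → ℝ), IsPF (fun x => f (x - v)) ∧ Continuous f ∧
      (∀ (t : ℝ) y, f (t • y) = t ^ (2 * (k + 1)) * f y) ∧
      (∀ y, Cone l b v y → 0 ≤ f y) ∧
      (∀ y, ¬ Cone l b v y → 0 ≤ ⟪n v, y⟫ → 0 ≤ ∏ i : {i // b i + ⟪l i, v⟫ = 0}, ⟪l i, y⟫ → f y < 0) ∧
      ∃ c : ℝ, 0 < c ∧ ∀ i j d y, i ≠ j → b i + ⟪l i, v⟫ = 0 → b j + ⟪l j, v⟫ = 0 → d ≠ 0 → Cone l b v d →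
        ⟪l i, d⟫ = 0 → ⟪l j, d⟫ = 0 → ⟪l i, y⟫ ≤ 0 → ⟪l j, y⟫ ≤ 0 → 0 < ⟪n v, y⟫ →
        f y ≤ c * ⟪n v, y⟫ ^ (2 * k + 1) * (⟪l i, y⟫ + ⟪l j, y⟫) := by
  classical
  set R := Rays l b n v with hR
  have hRfin : R.Finite := h.rays_finite hv
  haveI : Fintype R := hRfin.fintype
  choose ie je hne hie hje hie0 hje0 using fun e : R => e.2.2.2
  have hn1 : ∀ e : R, ⟪n v, (e : E 3)⟫ = 1 := fun e => e.2.1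
  have hcn : ∀ e : R, Cone l b v e := fun e => e.2.2.1
  set tv : R → E 3 := fun e => l (ie e) + l (je e) with htv
  -- scale
  obtain ⟨κ1, hκ1, hκ1b⟩ := exists_scale (fun p : R × R => ⟪tv p.1, (p.2 : E 3)⟫)
  obtain ⟨κ2, hκ2, hκ2b⟩ := exists_scale (fun p : Fin m × R => ⟪l p.1, (p.2 : E 3)⟫)
  have htvpos : ∀ e e' : R, 0 ≤ ⟪tv e, (e' : E 3)⟫ := fun e e' => by
    simp only [htv, inner_add_left]
    exact add_nonneg (hcn e' _ (hie e)) (hcn e' _ (hje e))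
  set κ := min κ1 κ2 with hκ
  have hκ0 : 0 < κ := lt_min hκ1 hκ2
  have hκt : ∀ e e' : R, κ * ⟪tv e, (e' : E 3)⟫ ≤ 1 := fun e e' =>
    (mul_le_mul_of_nonneg_right (min_le_left _ _) (htvpos e e')).trans (hκ1b (e, e'))
  have hκl : ∀ i, b i + ⟪l i, v⟫ = 0 → ∀ e : R, κ * ⟪l i, (e : E 3)⟫ ≤ 1 := fun i hi e =>
    (mul_le_mul_of_nonneg_right (min_le_right _ _) (hcn e i hi)).trans (hκ2b (i, e))
  have htv0 : ∀ e : R, ⟪tv e, (e : E 3)⟫ = 0 := fun e => by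
    simp only [htv, inner_add_left, hie0, hje0, add_zero]
  have htvne : ∀ e e' : R, e ≠ e' → 0 < ⟪tv e, (e' : E 3)⟫ := by
    intro e e' hee
    refine lt_of_le_of_ne (htvpos e e') fun h0 => hee ?_
    simp only [htv, inner_add_left] at h0
    have h1 := hcn e' _ (hie e)
    have h2 := hcn e' _ (hje e)
    exact Subtype.ext (h.ray_unique hv (hne e) (hie e) (hje e) (hn1 e) (hn1 e') (hie0 e) (hje0 e)
      (by linarith) (by linarith))
  obtain ⟨η, hη, hnear⟩ := h.near_cone v
  set η' := min (1/2) (κ * η) with hη'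
  have hη'0 : 0 < η' := lt_min (by norm_num) (by positivity)
  have hη'1 : η' ≤ 1/2 := min_le_left _ _
  have hη'2 : η' ≤ κ * η := min_le_right _ _
  set hvec : R → E 3 := fun e => n v - κ • tv e with hhvec
  set gvec : {i // b i + ⟪l i, v⟫ = 0} → E 3 := fun F => (1 - η') • n v - κ • l F with hgvec
  have hhin : ∀ e y, ⟪hvec e, y⟫ = ⟪n v, y⟫ - κ * ⟪tv e, y⟫ := fun e y => by
    simp only [hhvec, inner_sub_left, inner_smul_left]; simp
  have hgin : ∀ F y, ⟪gvec F, y⟫ = (1 - η') * ⟪n v, y⟫ - κ * ⟪l F, y⟫ := fun F y => by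
    simp only [hgvec, inner_sub_left, inner_smul_left]; simp
  have hCe : ∀ e : R, ∃ C : ℝ, 0 ≤ C ∧ ∀ y, ⟪n v, y⟫ = 0 → ‖y‖ ≤ C * (|⟪l (ie e), y⟫| + |⟪l (je e), y⟫|) := by
    intro e
    refine three_bound _ _ _ fun y h1 h2 h3 => ?_
    obtain ⟨t, ht⟩ := h.ind (ie e) (je e) v e y (hne e) (h.mem hv) (hie e) (hje e)
      (ne_zero_of_inner_one (hn1 e)) (hie0 e) (hje0 e) h2 h3
    rw [ht, inner_smul_right, hn1 e, mul_one] at h1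
    rw [ht, h1, zero_smul]
  choose Ce hCe0 hCeb using hCe
  obtain ⟨M1, hM1⟩ := (Set.finite_range (fun p : R × R => ‖hvec p.2‖ * Ce p.1)).bddAbove
  obtain ⟨M2, hM2⟩ := (Set.finite_range (fun p : R × {i // b i + ⟪l i, v⟫ = 0} => ‖gvec p.2‖ * Ce p.1)).bddAbove
  set M := (|M1| + |M2|) / κ with hM
  have hMκ : M * κ = |M1| + |M2| := by rw [hM]; field_simp
  have hM1' : ∀ e k, ‖hvec k‖ * Ce e ≤ M * κ := fun e k => by
    have := hM1 (mem_range_self (e, k))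
    rw [hMκ]; linarith [le_abs_self M1, abs_nonneg M2]
  have hM2' : ∀ e k, ‖gvec k‖ * Ce e ≤ M * κ := fun e k => by
    have := hM2 (mem_range_self (e, k))
    rw [hMκ]; linarith [le_abs_self M2, abs_nonneg M1]
  obtain ⟨k, c, hc, hsum, htan⟩ := aux_numeric (fun e e' : R => ⟪hvec e', (e : E 3)⟫)
    (fun (e : R) F => ⟪gvec F, (e : E 3)⟫) (fun e => by simp only [hhin, hn1, htv0]; ring)
    (fun e e' hee => by
      simp only [hhin, hn1]
      have h1 := hκt e' e
      have h2 := mul_pos hκ0 (htvne e' e hee.symm)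
      rw [abs_lt]; constructor <;> linarith)
    (fun e F => by
      simp only [hgin, hn1]
      have h1 := hκl F F.2 e
      have h2 := mul_nonneg hκ0.le (hcn e F F.2)
      rw [abs_lt]; constructor <;> linarith) M (by positivity)
  set f : E 3 → ℝ := fun y => ⟪n v, y⟫ ^ (2 * (k + 1)) - ∑ e, c e * ⟪hvec e, y⟫ ^ (2 * (k + 1))
    - ∑ F, ⟪gvec F, y⟫ ^ (2 * (k + 1)) with hf
  have hhom : ∀ (t : ℝ) y, f (t • y) = t ^ (2 * (k + 1)) * f y := by
    intro t y
    simp only [hf, inner_smul_right, mul_pow, mul_sub, Finset.mul_sum]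
    congr 2
    refine Finset.sum_congr rfl fun e _ => by ring
  have hcd : ∀ i j d y, i ≠ j → b i + ⟪l i, v⟫ = 0 → b j + ⟪l j, v⟫ = 0 → d ≠ 0 → Cone l b v d →
        ⟪l i, d⟫ = 0 → ⟪l j, d⟫ = 0 → ⟪l i, y⟫ ≤ 0 → ⟪l j, y⟫ ≤ 0 → 0 < ⟪n v, y⟫ →
        f y ≤ (1/2 * κ) * ⟪n v, y⟫ ^ (2 * k + 1) * (⟪l i, y⟫ + ⟪l j, y⟫) := by
    intro i j d y hij hi hj hd hcone hid hjd hiy hjy hN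
    have hdpos := h.cone_pos hv hcone hd
    set e0 : E 3 := (⟪n v, d⟫)⁻¹ • d with he0
    have hmem : e0 ∈ R := by
      refine ⟨?_, fun i' hi' => ?_, i, j, hij, hi, hj, ?_, ?_⟩
      · rw [he0, inner_smul_right, inv_mul_cancel₀ hdpos.ne']
      · rw [he0, inner_smul_right]; exact mul_nonneg (inv_nonneg.2 hdpos.le) (hcone i' hi')
      · rw [he0, inner_smul_right, hid, mul_zero]
      · rw [he0, inner_smul_right, hjd, mul_zero]
    set e : R := ⟨e0, hmem⟩ with he
    have hie' : ⟪l i, (e : E 3)⟫ = 0 := by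
      change ⟪l i, e0⟫ = 0; rw [he0, inner_smul_right, hid, mul_zero]
    have hje' : ⟪l j, (e : E 3)⟫ = 0 := by
      change ⟪l j, e0⟫ = 0; rw [he0, inner_smul_right, hjd, mul_zero]
    have hene := ne_zero_of_inner_one (hn1 e)
    have hcase : ∀ i', b i' + ⟪l i', v⟫ = 0 → ⟪l i', (e : E 3)⟫ = 0 → i' = ie e ∨ i' = je e := by
      intro i' hi' hi'e
      by_contra hcon
      push Not at hcon
      exact h.irr i' (ie e) (je e) v e hcon.1 hcon.2 (hne e) (h.mem hv) hi' (hie e) (hje e) hene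
        hi'e (hie0 e) (hje0 e)
    have hpair : (⟪l (ie e), y⟫ ≤ 0 ∧ ⟪l (je e), y⟫ ≤ 0) ∧ ⟪l i, y⟫ + ⟪l j, y⟫ = ⟪l (ie e), y⟫ + ⟪l (je e), y⟫ := by
      rcases hcase i hi hie' with h1 | h1 <;> rcases hcase j hj hje' with h2 | h2
      · exact absurd (h1.trans h2.symm) hij
      · rw [← h1, ← h2]; exact ⟨⟨hiy, hjy⟩, rfl⟩
      · rw [← h1, ← h2]; exact ⟨⟨hjy, hiy⟩, add_comm _ _⟩
      · exact absurd (h1.trans h2.symm) hij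
    obtain ⟨⟨hiey, hjey⟩, hpe⟩ := hpair
    set N := ⟪n v, y⟫ with hNdef
    set y' : E 3 := N⁻¹ • y with hy'
    have hny' : ⟪n v, y'⟫ = 1 := by rw [hy', inner_smul_right, inv_mul_cancel₀ hN.ne']
    have hi1 : ⟪l (ie e), y'⟫ ≤ 0 := by
      rw [hy', inner_smul_right]; exact mul_nonpos_of_nonneg_of_nonpos (inv_nonneg.2 hN.le) hiey
    have hj1 : ⟪l (je e), y'⟫ ≤ 0 := by
      rw [hy', inner_smul_right]; exact mul_nonpos_of_nonneg_of_nonpos (inv_nonneg.2 hN.le) hjey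
    have hse : ⟪hvec e, y'⟫ - 1 = -κ * (⟪l (ie e), y'⟫ + ⟪l (je e), y'⟫) := by
      rw [hhin, hny']; simp only [htv, inner_add_left]; ring
    have hse0 : 0 ≤ ⟪hvec e, y'⟫ - 1 := by rw [hse]; nlinarith
    have hnorm : ‖y' - e‖ ≤ Ce e * -(⟪l (ie e), y'⟫ + ⟪l (je e), y'⟫) := by
      have := hCeb e (y' - e) (by rw [inner_sub_right, hny', hn1, sub_self])
      rw [inner_sub_right, inner_sub_right, hie0, hje0, sub_zero, sub_zero, abs_of_nonpos hi1,
        abs_of_nonpos hj1] at this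
      linarith
    have hgen : ∀ a : E 3, ‖a‖ * Ce e ≤ M * κ → |⟪a, y'⟫ - ⟪a, (e : E 3)⟫| ≤ M * (⟪hvec e, y'⟫ - 1) := by
      intro a ha
      rw [← inner_sub_right, hse]
      have h1 := abs_real_inner_le_norm a (y' - e)
      have h2 := mul_le_mul_of_nonneg_left hnorm (norm_nonneg a)
      have h3 := mul_le_mul_of_nonneg_right ha
        (show 0 ≤ -(⟪l (ie e), y'⟫ + ⟪l (je e), y'⟫) by linarith)
      linarith
    have key := htan e (fun k => ⟪hvec k, y'⟫) (fun F => ⟪gvec F, y'⟫) (by linarith)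
      (fun k => hgen _ (hM1' e k)) (fun k => hgen _ (hM2' e k))
    have hfy' : f y' ≤ (1/2 * κ) * (⟪l i, y'⟫ + ⟪l j, y'⟫) := by
      simp only [hf, hny', one_pow]
      have e5 : ⟪l i, y'⟫ + ⟪l j, y'⟫ = ⟪l (ie e), y'⟫ + ⟪l (je e), y'⟫ := by
        simp only [hy', inner_smul_right, ← mul_add, hpe]
      rw [e5]
      rw [hse] at key
      linarith
    have hyy : y = N • y' := by rw [hy', smul_smul, mul_inv_cancel₀ hN.ne', one_smul]
    have h9 : f y = N ^ (2 * (k + 1)) * f y' := by rw [← hhom, ← hyy]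
    have h10 : ⟪l i, y⟫ + ⟪l j, y⟫ = N * (⟪l i, y'⟫ + ⟪l j, y'⟫) := by
      rw [hyy]; simp only [inner_smul_right]; ring
    rw [h9, h10]
    have := mul_le_mul_of_nonneg_left hfy' (show 0 ≤ N ^ (2 * (k + 1)) by positivity)
    calc _ ≤ _ := this
      _ = _ := by ring
  refine ⟨k, f, ?_, ?_, hhom, ?_, ?_, 1/2 * κ, by positivity, hcd⟩
  · refine (((IsPF.innerSub _ _).pow _).sub (IsPF.sum _ fun w => (IsPF.const _).mul (IsPF.pow ?_ _))).sub
      (IsPF.sum _ fun F => IsPF.pow ?_ _)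
    · exact IsPF.innerSub _ _
    · exact IsPF.innerSub _ _
  · simp only [hf]; fun_prop
  · -- nonneg on the cone
    have hcv : Convex ℝ {y : E 3 | ∑ e, c e * ⟪hvec e, y⟫ ^ (2 * (k + 1)) + ∑ F, ⟪gvec F, y⟫ ^ (2 * (k + 1)) ≤ 1} := by
      intro x hx y hy s t hs ht hst
      simp only [mem_ofPred_eq] at *
      have h1 : ∑ e, c e * ⟪hvec e, s • x + t • y⟫ ^ (2 * (k + 1)) ≤
          ∑ e, (s * (c e * ⟪hvec e, x⟫ ^ (2 * (k + 1))) + t * (c e * ⟪hvec e, y⟫ ^ (2 * (k + 1)))) := by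
        refine Finset.sum_le_sum fun w _ => ?_
        rw [inner_add_right, inner_smul_right, inner_smul_right]
        have := mul_le_mul_of_nonneg_left (pow_conv_le k ⟪hvec w, x⟫ ⟪hvec w, y⟫ s t hs ht hst) (hc w).le
        linarith
      have h2 : ∑ F, ⟪gvec F, s • x + t • y⟫ ^ (2 * (k + 1)) ≤
          ∑ F, (s * ⟪gvec F, x⟫ ^ (2 * (k + 1)) + t * ⟪gvec F, y⟫ ^ (2 * (k + 1))) := by
        refine Finset.sum_le_sum fun w _ => ?_
        rw [inner_add_right, inner_smul_right, inner_smul_right]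
        exact pow_conv_le k _ _ s t hs ht hst
      rw [Finset.sum_add_distrib, ← Finset.mul_sum, ← Finset.mul_sum] at h1 h2
      have h3 := mul_le_mul_of_nonneg_left hx hs
      have h4 := mul_le_mul_of_nonneg_left hy ht
      linarith
    intro y hy
    by_cases hy0 : y = 0
    · subst hy0
      simp [hf]
    have hN := h.cone_pos hv hy hy0
    set y' : E 3 := (⟪n v, y⟫)⁻¹ • y with hy'
    have hny' : ⟪n v, y'⟫ = 1 := by rw [hy', inner_smul_right, inv_mul_cancel₀ hN.ne']
    have hcy' : Cone l b v y' := fun i hi => by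
      rw [hy', inner_smul_right]; exact mul_nonneg (inv_nonneg.2 hN.le) (hy i hi)
    have hm := convexHull_min (s := R) (fun e he => (hsum ⟨e, he⟩).le) hcv (h.section_hull hv hny' hcy')
    have hfy' : 0 ≤ f y' := by
      simp only [mem_ofPred_eq] at hm
      simp only [hf, hny', one_pow]; linarith
    have hyy : y = ⟪n v, y⟫ • y' := by rw [hy', smul_smul, mul_inv_cancel₀ hN.ne', one_smul]
    rw [hyy, hhom]
    positivity
  · intro y hy hN hprod
    have hs1 : 0 ≤ ∑ e, c e * ⟪hvec e, y⟫ ^ (2 * (k + 1)) := Finset.sum_nonneg fun w _ =>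
      mul_nonneg (hc w).le (Even.pow_nonneg (even_two_mul _) _)
    have hs2 : ∀ F, ⟪gvec F, y⟫ ^ (2 * (k + 1)) ≤ ∑ F, ⟪gvec F, y⟫ ^ (2 * (k + 1)) := fun F =>
      Finset.single_le_sum (f := fun F => ⟪gvec F, y⟫ ^ (2 * (k + 1)))
        (fun F _ => Even.pow_nonneg (even_two_mul _) _) (Finset.mem_univ F)
    rcases hN.eq_or_lt with hN0 | hNpos
    · have hy' := hy
      simp only [Cone] at hy'
      push Not at hy'
      obtain ⟨i, hi, hiy⟩ := hy'
      have h1 := hs2 ⟨i, hi⟩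
      have h2 : 0 < ⟪gvec ⟨i, hi⟩, y⟫ := by
        rw [hgin, ← hN0]; nlinarith
      have h3 : 0 < ⟪gvec ⟨i, hi⟩, y⟫ ^ (2 * (k + 1)) := by positivity
      simp only [hf, ← hN0]
      rw [zero_pow (by omega)]
      linarith
    · by_contra hcon
      push Not at hcon
      have hall : ∀ i, b i + ⟪l i, v⟫ = 0 → -η * ⟪n v, y⟫ ≤ ⟪l i, y⟫ := by
        intro i hi
        have h1 := hs2 ⟨i, hi⟩
        have h2 : ⟪gvec ⟨i, hi⟩, y⟫ ^ (2 * (k + 1)) ≤ ⟪n v, y⟫ ^ (2 * (k + 1)) := by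
          simp only [hf] at hcon; linarith
        have h3 : ⟪gvec ⟨i, hi⟩, y⟫ ≤ ⟪n v, y⟫ := by
          by_contra hlt
          push Not at hlt
          have := pow_lt_pow_left₀ hlt hN (show 2 * (k + 1) ≠ 0 by omega)
          linarith
        rw [hgin] at h3
        have h4 := mul_le_mul_of_nonneg_right hη'2 hN
        have : κ * (-η * ⟪n v, y⟫) ≤ κ * ⟪l i, y⟫ := by
          simp only at h3
          linarith
        exact le_of_mul_le_mul_left this hκ0
      obtain ⟨i, j, d, hij, hi, hj, hd, hcone, hid, hjd, hiy, hjy⟩ := hnear y hNpos hall hy hprod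
      have h1 := hcd i j d y hij hi hj hd hcone hid hjd hiy.le hjy hNpos
      have h2 : 0 < (1/2 * κ) * ⟪n v, y⟫ ^ (2 * k + 1) := by positivity
      nlinarith
end PD

lemma ultra_pick {κ : Type*} [Finite κ] (U : Ultrafilter ℕ) (Q : κ → ℕ → Prop)
    (h : ∀ᶠ N in (U : Filter ℕ), ∃ a, Q a N) : ∃ a, ∀ᶠ N in (U : Filter ℕ), Q a N := by
  by_contra hcon
  push Not at hcon
  have h1 : ∀ᶠ N in (U : Filter ℕ), ∀ a, ¬ Q a N :=
    Filter.eventually_all.2 hcon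
  obtain ⟨N, ⟨a, ha⟩, hN⟩ := (h.and h1).exists
  exact hN a ha

lemma sum_dom {V : Finset (E 3)} {v0 : E 3} (hv : v0 ∈ V) (T : E 3 → ℕ → ℝ) (U : Filter ℕ)
    (ε : ℕ → ℝ) (hε : ∀ᶠ N in U, 0 < ε N) (c : ℝ) (hc : 0 < c)
    (h0 : ∀ᶠ N in U, T v0 N ≤ -c * ε N)
    (h1 : ∀ u ∈ V, u ≠ v0 → ∀ η : ℝ, 0 < η → ∀ᶠ N in U, T u N ≤ η * ε N) :
    ∀ᶠ N in U, ∑ u ∈ V, T u N < 0 := by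
  classical
  have hη : 0 < c / (2 * (V.card + 1)) := by positivity
  have h2 : ∀ᶠ N in U, ∀ u ∈ V.erase v0, T u N ≤ c / (2 * (V.card + 1)) * ε N :=
    (Filter.eventually_all_finset _).2 fun u hu =>
      h1 u (Finset.mem_of_mem_erase hu) (Finset.ne_of_mem_erase hu) _ hη
  filter_upwards [hε, h0, h2] with N a1 a2 a3
  rw [← Finset.add_sum_erase V (fun u => T u N) hv]
  have h3 := Finset.sum_le_sum a3
  rw [Finset.sum_const, nsmul_eq_mul] at h3
  have h4 : ((V.erase v0).card : ℝ) ≤ V.card + 1 := by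
    have := Finset.card_erase_le (s := V) (a := v0)
    have : ((V.erase v0).card : ℝ) ≤ V.card := by exact_mod_cast this
    linarith
  have h5 : ((V.erase v0).card : ℝ) * (c / (2 * (V.card + 1)) * ε N) ≤
      (V.card + 1) * (c / (2 * (V.card + 1)) * ε N) :=
    mul_le_mul_of_nonneg_right h4 (by positivity)
  have h6 : ((V.card : ℝ) + 1) * (c / (2 * (V.card + 1)) * ε N) = c / 2 * ε N := by
    field_simp
  have h7 := mul_pos hc a1
  have : (fun u => T u N) v0 = T v0 N := rfl
  linarith

namespace PD
variable {m : ℕ} {V : Finset (E 3)} {l : Fin m → E 3} {b : Fin m → ℝ} {n : E 3 → E 3}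

/-- the conclusion of `lemB` -/
def LB (l : Fin m → E 3) (b : Fin m → ℝ) (n : E 3 → E 3) (v : E 3) (k : ℕ) (f : E 3 → ℝ) : Prop :=
    IsPF (fun x => f (x - v)) ∧ Continuous f ∧
      (∀ (t : ℝ) y, f (t • y) = t ^ (2 * (k + 1)) * f y) ∧
      (∀ y, Cone l b v y → 0 ≤ f y) ∧
      (∀ y, ¬ Cone l b v y → 0 ≤ ⟪n v, y⟫ → 0 ≤ ∏ i : {i // b i + ⟪l i, v⟫ = 0}, ⟪l i, y⟫ → f y < 0) ∧
      ∃ c : ℝ, 0 < c ∧ ∀ i j d y, i ≠ j → b i + ⟪l i, v⟫ = 0 → b j + ⟪l j, v⟫ = 0 → d ≠ 0 → Cone l b v d →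
        ⟪l i, d⟫ = 0 → ⟪l j, d⟫ = 0 → ⟪l i, y⟫ ≤ 0 → ⟪l j, y⟫ ≤ 0 → 0 < ⟪n v, y⟫ →
        f y ≤ c * ⟪n v, y⟫ ^ (2 * k + 1) * (⟪l i, y⟫ + ⟪l j, y⟫)

open Classical in
/-- weight of a vertex -/
def W (l : Fin m → E 3) (b : Fin m → ℝ) (K : ℕ) (u x : E 3) : ℝ :=
  ∏ i, if b i + ⟪l i, u⟫ = 0 then 1 else (b i + ⟪l i, x⟫) ^ (2 * K)

lemma W_cont (K : ℕ) (u : E 3) : Continuous (W l b K u) := by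
  unfold W
  refine continuous_finsetProd _ fun i _ => ?_
  split_ifs <;> fun_prop

lemma W_nonneg (K : ℕ) (u x : E 3) : 0 ≤ W l b K u x := by
  refine Finset.prod_nonneg fun i _ => ?_
  split_ifs
  · exact zero_le_one
  · exact Even.pow_nonneg (even_two_mul K) _

lemma W_pos (K : ℕ) (u x : E 3) (hx : ∀ i, b i + ⟪l i, u⟫ ≠ 0 → b i + ⟪l i, x⟫ ≠ 0) :
    0 < W l b K u x := by
  refine Finset.prod_pos fun i _ => ?_
  split_ifs with h
  · exact zero_lt_one
  · exact Even.pow_pos (even_two_mul K) (hx i h)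

lemma W_PF (K : ℕ) (u : E 3) : IsPF (W l b K u) := by
  refine IsPF.prod Finset.univ (f := fun i x => _) fun i => ?_
  split_ifs
  · exact IsPF.const 1
  · exact ((IsPF.const (b i)).add (IsPF.inner (l i))).pow _

open Filter Topology in
lemma small {K : ℕ} {u z : E 3} {f : E 3 → ℝ} (hf : Continuous f) {F : Fin m}
    (hF : b F + ⟪l F, u⟫ ≠ 0) {U : Filter ℕ} {x : ℕ → E 3} (hx : Tendsto x U (𝓝 z))
    {s ε : ℕ → ℝ} (hs : Tendsto s U (𝓝 0)) (hε : ∀ᶠ N in U, 0 < ε N)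
    (hq : ∀ᶠ N in U, (b F + ⟪l F, x N⟫) ^ (2 * K) ≤ s N * ε N) (η : ℝ) (hη : 0 < η) :
    ∀ᶠ N in U, W l b K u (x N) * f (x N - u) ≤ η * ε N := by
  classical
  set g : E 3 → ℝ := fun x => (∏ i ∈ Finset.univ.erase F, if b i + ⟪l i, u⟫ = 0 then 1 else
    (b i + ⟪l i, x⟫) ^ (2 * K)) * f (x - u) with hg
  have hgc : Continuous g := by
    refine Continuous.mul (continuous_finsetProd _ fun i _ => ?_) (by fun_prop)
    split_ifs <;> fun_prop
  have hW : ∀ x, W l b K u x * f (x - u) = (b F + ⟪l F, x⟫) ^ (2 * K) * g x := by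
    intro x
    rw [W, ← Finset.mul_prod_erase _ _ (Finset.mem_univ F), if_neg hF, mul_assoc]
  have h1 : Tendsto (fun N => |g (x N)|) U (𝓝 |g z|) := ((hgc.tendsto z).comp hx).abs
  have h2 : Tendsto (fun N => s N * |g (x N)|) U (𝓝 0) := by simpa using hs.mul h1
  filter_upwards [hε, hq, h2.eventually_le_const hη] with N a1 a2 a3
  rw [hW]
  have h3 : 0 ≤ (b F + ⟪l F, x N⟫) ^ (2 * K) := Even.pow_nonneg (even_two_mul K) _
  calc _ ≤ (b F + ⟪l F, x N⟫) ^ (2 * K) * |g (x N)| := mul_le_mul_of_nonneg_left (le_abs_self _) h3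
    _ ≤ s N * ε N * |g (x N)| := mul_le_mul_of_nonneg_right a2 (abs_nonneg _)
    _ = (s N * |g (x N)|) * ε N := by ring
    _ ≤ _ := mul_le_mul_of_nonneg_right a3 a1.le

open Filter Topology in
lemma term_nonpos (h : PD m V l b n) {K k : ℕ} {u z : E 3} {f : E 3 → ℝ} (hu : u ∈ V)
    (hB : LB l b n u k f) {U : Filter ℕ} {x : ℕ → E 3} (hx : Tendsto x U (𝓝 z))
    (hz : z ∈ convexHull ℝ (V : Set (E 3))) (hzu : z ≠ u) {i j : Fin m} (hij : i ≠ j)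
    (hiu : b i + ⟪l i, u⟫ = 0) (hju : b j + ⟪l j, u⟫ = 0)
    (hiz : b i + ⟪l i, z⟫ = 0) (hjz : b j + ⟪l j, z⟫ = 0)
    (hix : ∀ᶠ N in U, b i + ⟪l i, x N⟫ < 0) (hjx : ∀ᶠ N in U, b j + ⟪l j, x N⟫ ≤ 0) :
    ∃ c : ℝ, 0 < c ∧ ∀ᶠ N in U, W l b K u (x N) * f (x N - u) ≤
      -(c * W l b K u (x N) * (-(b i + ⟪l i, x N⟫) - (b j + ⟪l j, x N⟫))) := by
  obtain ⟨-, -, -, -, -, c, hc, hB⟩ := hB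
  have hpos := h.pos_of_mem hu hz hzu
  have hlim : Tendsto (fun N => ⟪n u, x N - u⟫) U (𝓝 ⟪n u, z - u⟫) :=
    (Continuous.tendsto (f := fun x => ⟪n u, x - u⟫) (by fun_prop) z).comp hx
  refine ⟨c * (⟪n u, z - u⟫ / 2) ^ (2 * k + 1), by positivity, ?_⟩
  filter_upwards [hix, hjx, hlim.eventually_const_le (half_lt_self hpos)] with N a1 a2 a3
  have ei := q_sub (l := l) (b := b) i u (x N)
  have ej := q_sub (l := l) (b := b) j u (x N)
  have ei' := q_sub (l := l) (b := b) i u z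
  have ej' := q_sub (l := l) (b := b) j u z
  rw [hiu, zero_add] at ei ei'
  rw [hju, zero_add] at ej ej'
  have := hB i j (z - u) (x N - u) hij hiu hju (sub_ne_zero.2 hzu) (h.cone_of_mem hz)
    (ei'.symm.trans hiz) (ej'.symm.trans hjz) (ei ▸ a1.le) (ej ▸ a2) (by linarith)
  rw [← ei, ← ej] at this
  have hp : (⟪n u, z - u⟫ / 2) ^ (2 * k + 1) ≤ ⟪n u, x N - u⟫ ^ (2 * k + 1) :=
    pow_le_pow_left₀ (by positivity) a3 _
  have h1 : c * ⟪n u, x N - u⟫ ^ (2 * k + 1) * (b i + ⟪l i, x N⟫ + (b j + ⟪l j, x N⟫)) ≤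
      c * (⟪n u, z - u⟫ / 2) ^ (2 * k + 1) * (b i + ⟪l i, x N⟫ + (b j + ⟪l j, x N⟫)) :=
    mul_le_mul_of_nonpos_right (mul_le_mul_of_nonneg_left hp hc.le) (by linarith)
  have h2 := mul_le_mul_of_nonneg_left (this.trans h1) (W_nonneg (l := l) (b := b) K u (x N))
  linarith

lemma exists_vertex (h : PD m V l b n) {z : E 3} (hz : z ∈ convexHull ℝ (V : Set (E 3))) :
    ∃ v ∈ V, ∀ i, b i + ⟪l i, z⟫ = 0 → b i + ⟪l i, v⟫ = 0 := by
  obtain ⟨w, hw, hw1, hwz⟩ := Finset.mem_convexHull'.1 hz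
  have : ∃ v ∈ V, 0 < w v := by
    by_contra hcon
    push Not at hcon
    have := Finset.sum_nonpos hcon
    linarith
  obtain ⟨v, hv, hwv⟩ := this
  refine ⟨v, hv, fun i hi => ?_⟩
  have h1 : b i + ⟪l i, z⟫ = ∑ y ∈ V, w y * (b i + ⟪l i, y⟫) := by
    rw [← hwz, inner_sum]
    simp only [inner_smul_right, mul_add, Finset.sum_add_distrib]
    rw [← Finset.sum_mul, hw1, one_mul]
  rw [hi] at h1
  have h2 := (Finset.sum_eq_zero_iff_of_nonneg (fun y hy =>
    mul_nonneg (hw y hy) ((h.hP y).1 (h.mem hy) i))).1 h1.symm v hv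
  exact (mul_eq_zero.1 h2).resolve_left hwv.ne'
end PD

namespace PD
variable {m : ℕ} {V : Finset (E 3)} {l : Fin m → E 3} {b : Fin m → ℝ} {n : E 3 → E 3}

open Filter Topology in
lemma q_tendsto (i : Fin m) {U : Filter ℕ} {x : ℕ → E 3} {z : E 3} (hx : Tendsto x U (𝓝 z)) :
    Tendsto (fun N => b i + ⟪l i, x N⟫) U (𝓝 (b i + ⟪l i, z⟫)) :=
  (Continuous.tendsto (f := fun x => b i + ⟪l i, x⟫) (by fun_prop) z).comp hx

open Filter Topology in
lemma caseA (h : PD m V l b n) {K : ℕ} (hK : 1 ≤ K) {k : E 3 → ℕ} {f : E 3 → E 3 → ℝ}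
    (hB : ∀ v ∈ V, LB l b n v (k v) (f v)) {x : ℕ → E 3} {z : E 3}
    (hz : z ∈ convexHull ℝ (V : Set (E 3))) (hzV : z ∉ V)
    (hx : Tendsto x (hyperfilter ℕ : Filter ℕ) (𝓝 z))
    (hout : ∀ N, ∃ i, b i + ⟪l i, x N⟫ < 0)
    (hprod : ∀ N, 0 ≤ ∏ i, (b i + ⟪l i, x N⟫))
    (hp : ∀ N, 0 ≤ ∑ v ∈ V, W l b K v (x N) * f v (x N - v)) : False := by
  classical
  have hpos : ∀ᶠ N in (hyperfilter ℕ : Filter ℕ), ∀ i, b i + ⟪l i, z⟫ ≠ 0 → 0 < b i + ⟪l i, x N⟫ := by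
    refine eventually_all.2 fun i => ?_
    by_cases hi : b i + ⟪l i, z⟫ = 0
    · exact Eventually.of_forall fun N hne => absurd hi hne
    · have h0 := lt_of_le_of_ne ((h.hP z).1 hz i) (Ne.symm hi)
      filter_upwards [(q_tendsto (l := l) (b := b) i hx).eventually_const_lt h0] with N hN _ using hN
  obtain ⟨⟨i, j⟩, hpair⟩ := ultra_pick (hyperfilter ℕ) (κ := Fin m × Fin m)
    (fun p N => p.1 ≠ p.2 ∧ b p.1 + ⟪l p.1, z⟫ = 0 ∧ b p.2 + ⟪l p.2, z⟫ = 0 ∧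
      b p.1 + ⟪l p.1, x N⟫ < 0 ∧ b p.2 + ⟪l p.2, x N⟫ ≤ 0) (by
      filter_upwards [hpos] with N hN
      obtain ⟨i, j, h1⟩ := aux_loc _ _ hN (hprod N) (hout N)
      exact ⟨(i, j), h1⟩)
  obtain ⟨N0, hij, hiz, hjz, -, -⟩ := hpair.exists
  have hix : ∀ᶠ N in (hyperfilter ℕ : Filter ℕ), b i + ⟪l i, x N⟫ < 0 := hpair.mono fun N hN => hN.2.2.2.1
  have hjx : ∀ᶠ N in (hyperfilter ℕ : Filter ℕ), b j + ⟪l j, x N⟫ ≤ 0 := hpair.mono fun N hN => hN.2.2.2.2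
  obtain ⟨v, hv, hvz⟩ := h.exists_vertex hz
  have hvz' : z ≠ v := fun e => hzV (e ▸ hv)
  have hWz : 0 < W l b K v z := by
    refine W_pos K v z fun F hF hFz => hF (hvz F hFz)
  set δ : ℕ → ℝ := fun N => -(b i + ⟪l i, x N⟫) - (b j + ⟪l j, x N⟫) with hδ
  have hδpos : ∀ᶠ N in (hyperfilter ℕ : Filter ℕ), 0 < δ N := by
    filter_upwards [hix, hjx] with N a1 a2
    simp only [hδ]; linarith
  have hδ0 : Tendsto δ (hyperfilter ℕ : Filter ℕ) (𝓝 0) := by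
    have := ((q_tendsto (l := l) (b := b) i hx).neg).sub (q_tendsto (l := l) (b := b) j hx)
    rwa [hiz, hjz, neg_zero, sub_zero] at this
  have hW : Tendsto (fun N => W l b K v (x N)) (hyperfilter ℕ : Filter ℕ) (𝓝 (W l b K v z)) :=
    ((W_cont K v).tendsto z).comp hx
  obtain ⟨c, hc, hcb⟩ := h.term_nonpos (K := K) hv (hB v hv) hx hz hvz' hij (hvz i hiz) (hvz j hjz) hiz hjz hix hjx
  have hfin := sum_dom hv (fun u N => W l b K u (x N) * f u (x N - u)) (hyperfilter ℕ : Filter ℕ) δ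
    hδpos (c * (W l b K v z / 2)) (by positivity) (by
      filter_upwards [hδpos, hcb, hW.eventually_const_le (half_lt_self hWz)] with N a1 a2 a3
      refine a2.trans ?_
      have := mul_le_mul_of_nonneg_right (mul_le_mul_of_nonneg_left a3 hc.le) a1.le
      simp only [hδ] at this ⊢
      linarith) (by
      intro u hu huv η hη
      by_cases hboth : b i + ⟪l i, u⟫ = 0 ∧ b j + ⟪l j, u⟫ = 0
      · obtain ⟨c', hc', hcb'⟩ := h.term_nonpos (K := K) hu (hB u hu) hx hz
          (fun e => hzV (e ▸ hu)) hij hboth.1 hboth.2 hiz hjz hix hjx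
        filter_upwards [hδpos, hcb'] with N a1 a2
        refine a2.trans ?_
        have h1 := mul_nonneg (mul_nonneg hc'.le (W_nonneg (l := l) (b := b) K u (x N))) a1.le
        have h2 := mul_pos hη a1
        simp only [hδ] at h1 h2 ⊢
        linarith
      · have hF : ∃ F, b F + ⟪l F, u⟫ ≠ 0 ∧ ∀ᶠ N in (hyperfilter ℕ : Filter ℕ), |b F + ⟪l F, x N⟫| ≤ δ N := by
          by_cases h1 : b i + ⟪l i, u⟫ = 0
          · refine ⟨j, fun h2 => hboth ⟨h1, h2⟩, ?_⟩
            filter_upwards [hix, hjx] with N a1 a2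
            rw [abs_of_nonpos a2]; simp only [hδ]; linarith
          · refine ⟨i, h1, ?_⟩
            filter_upwards [hix, hjx] with N a1 a2
            rw [abs_of_neg a1]; simp only [hδ]; linarith
        obtain ⟨F, hF, hFd⟩ := hF
        refine small (hB u hu).2.1 hF hx (s := fun N => δ N ^ (2 * K - 1)) ?_ hδpos ?_ η hη
        · have := hδ0.pow (2 * K - 1)
          rwa [zero_pow (by omega)] at this
        · filter_upwards [hFd] with N a1
          rw [← pow_succ, show 2 * K - 1 + 1 = 2 * K by omega, ← Even.pow_abs (even_two_mul K)]
          exact pow_le_pow_left₀ (abs_nonneg _) a1 _)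
  obtain ⟨N, hN⟩ := hfin.exists
  exact absurd (hp N) (not_le.2 hN)
end PD

namespace PD
variable {m : ℕ} {V : Finset (E 3)} {l : Fin m → E 3} {b : Fin m → ℝ} {n : E 3 → E 3}

open Filter Topology in
lemma caseB (h : PD m V l b n) {K : ℕ} {k : E 3 → ℕ} {f : E 3 → E 3 → ℝ}
    (hB : ∀ v ∈ V, LB l b n v (k v) (f v)) {x : ℕ → E 3} {v : E 3}
    (hv : v ∈ V) (hK : k v + 2 ≤ K)
    (hx : Tendsto x (hyperfilter ℕ : Filter ℕ) (𝓝 v))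
    (hout : ∀ N, ∃ i, b i + ⟪l i, x N⟫ < 0)
    (hnx : ∀ N : ℕ, -(1 / ((N : ℝ) + 1)) * ‖x N - v‖ ≤ ⟪n v, x N - v⟫)
    (hprod : ∀ N, 0 ≤ ∏ i, (b i + ⟪l i, x N⟫))
    (hp : ∀ N, 0 ≤ ∑ v ∈ V, W l b K v (x N) * f v (x N - v)) : False := by
  classical
  have hvP := (h.hP v).1 (h.mem hv)
  have hne : ∀ N, x N - v ≠ 0 := by
    intro N e
    obtain ⟨i, hi⟩ := hout N
    rw [sub_eq_zero.1 e] at hi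
    linarith [hvP i]
  set r : ℕ → ℝ := fun N => ‖x N - v‖ with hr
  have hr0 : ∀ N, 0 < r N := fun N => norm_pos_iff.2 (hne N)
  have hrl : Tendsto r (hyperfilter ℕ : Filter ℕ) (𝓝 0) := by
    have := (Continuous.tendsto (f := fun x : E 3 => ‖x - v‖) (by fun_prop) v).comp hx
    rw [sub_self, norm_zero] at this
    exact this
  set dN : ℕ → E 3 := fun N => (r N)⁻¹ • (x N - v) with hdN
  have hyd : ∀ N, x N - v = r N • dN N := fun N => by
    simp only [hdN]; rw [smul_inv_smul₀ (hr0 N).ne']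
  obtain ⟨d, hd, hdl⟩ := ultra_lim (isCompact_sphere (0 : E 3) 1) dN (fun N => by
    simp only [mem_sphere_zero_iff_norm, hdN, norm_smul, norm_inv, Real.norm_eq_abs]
    rw [abs_of_pos (hr0 N)]
    exact inv_mul_cancel₀ (hr0 N).ne')
  have hd0 : d ≠ 0 := by
    rintro rfl
    simp at hd
  have hinn : ∀ a : E 3, Tendsto (fun N => ⟪a, dN N⟫) (hyperfilter ℕ : Filter ℕ) (𝓝 ⟪a, d⟫) := fun a =>
    (Continuous.tendsto (f := fun x => ⟪a, x⟫) (by fun_prop) d).comp hdl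
  have hpos : ∀ᶠ N in (hyperfilter ℕ : Filter ℕ), ∀ i, b i + ⟪l i, v⟫ ≠ 0 → 0 < b i + ⟪l i, x N⟫ := by
    refine eventually_all.2 fun i => ?_
    by_cases hi : b i + ⟪l i, v⟫ = 0
    · exact Eventually.of_forall fun N hne => absurd hi hne
    · have h0 := lt_of_le_of_ne (hvP i) (Ne.symm hi)
      filter_upwards [(q_tendsto (l := l) (b := b) i hx).eventually_const_lt h0] with N hN _ using hN
  have hqa : ∀ i, b i + ⟪l i, v⟫ = 0 → ∀ N, b i + ⟪l i, x N⟫ = r N * ⟪l i, dN N⟫ := by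
    intro i hi N
    rw [q_sub i v, hi, zero_add, hyd N, inner_smul_right]
  have hqb : ∀ i, b i + ⟪l i, v⟫ = 0 → ∀ N, |b i + ⟪l i, x N⟫| ≤ ‖l i‖ * r N := by
    intro i hi N
    rw [q_sub i v, hi, zero_add]
    exact abs_real_inner_le_norm _ _
  have hWv : 0 < W l b K v v := W_pos K v v fun F hF => hF
  have hW : Tendsto (fun N => W l b K v (x N)) (hyperfilter ℕ : Filter ℕ) (𝓝 (W l b K v v)) :=
    ((W_cont K v).tendsto v).comp hx
  obtain ⟨-, hfc, hhom, -, hneg, c, hc, hlast⟩ := hB v hv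
  have hfd : Tendsto (fun N => f v (dN N)) (hyperfilter ℕ : Filter ℕ) (𝓝 (f v d)) := (hfc.tendsto d).comp hdl
  -- first part
  have hfd0 : 0 ≤ f v d := by
    by_contra hcon
    push Not at hcon
    have hL : Tendsto (fun N => W l b K v (x N) * f v (dN N)) (hyperfilter ℕ : Filter ℕ)
      (𝓝 (W l b K v v * f v d)) := hW.mul hfd
    have hLneg : W l b K v v * f v d < 0 := mul_neg_of_pos_of_neg hWv hcon
    have hε : ∀ᶠ N in (hyperfilter ℕ : Filter ℕ), 0 < r N ^ (2 * (k v + 1)) :=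
      Eventually.of_forall fun N => pow_pos (hr0 N) _
    have hfin := sum_dom hv (fun u N => W l b K u (x N) * f u (x N - u)) (hyperfilter ℕ : Filter ℕ)
      (fun N => r N ^ (2 * (k v + 1))) hε (-(W l b K v v * f v d) / 2) (by linarith) (by
        filter_upwards [hε, hL.eventually_le_const (show W l b K v v * f v d < W l b K v v * f v d / 2 by linarith)] with N a1 a2
        have := mul_le_mul_of_nonneg_right a2 a1.le
        rw [hyd N, hhom]
        linarith) (by
        intro u hu huv η hη
        obtain ⟨F, hFv, hFu⟩ := h.exists_facet_not hu hv huv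
        refine small (hB u hu).2.1 hFu hx
          (s := fun N => ‖l F‖ ^ (2 * K) * r N ^ (2 * K - 2 * (k v + 1))) ?_ hε ?_ η hη
        · have := (hrl.pow (2 * K - 2 * (k v + 1))).const_mul (‖l F‖ ^ (2 * K))
          rwa [zero_pow (by omega), mul_zero] at this
        · refine Eventually.of_forall fun N => ?_
          rw [mul_assoc, ← pow_add, show 2 * K - 2 * (k v + 1) + 2 * (k v + 1) = 2 * K by omega,
            ← Even.pow_abs (even_two_mul K), ← mul_pow]
          exact pow_le_pow_left₀ (abs_nonneg _) (hqb F hFv N) _)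
    obtain ⟨N, hN⟩ := hfin.exists
    exact absurd (hp N) (not_le.2 hN)
  have hnd : 0 ≤ ⟪n v, d⟫ := by
    refine le_of_tendsto_of_tendsto (b := (hyperfilter ℕ : Filter ℕ)) (f := fun N : ℕ => -(1 / ((N : ℝ) + 1)))
      (by simpa using hyper_inv.neg) (hinn (n v)) (Eventually.of_forall fun N => ?_)
    have h1 := hnx N
    nth_rewrite 2 [hyd N] at h1
    rw [inner_smul_right] at h1
    have h2 := hr0 N
    simp only [hr] at h1 h2 ⊢
    nlinarith
  have hpd : 0 ≤ ∏ i : {i // b i + ⟪l i, v⟫ = 0}, ⟪l i, d⟫ := by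
    have hT : Tendsto (fun N => ∏ i : {i // b i + ⟪l i, v⟫ = 0}, ⟪l i, dN N⟫) (hyperfilter ℕ : Filter ℕ)
        (𝓝 (∏ i : {i // b i + ⟪l i, v⟫ = 0}, ⟪l i, d⟫)) :=
      tendsto_finsetProd _ fun (i : {i // b i + ⟪l i, v⟫ = 0}) _ => hinn (l i)
    refine ge_of_tendsto hT ?_
    filter_upwards [hpos] with N hN
    have h1 := hprod N
    rw [← Fintype.prod_subtype_mul_prod_subtype (fun i => b i + ⟪l i, v⟫ = 0)] at h1
    have h2 : 0 < ∏ i : {i // ¬ (b i + ⟪l i, v⟫ = 0)}, (b i + ⟪l i, x N⟫) :=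
      Finset.prod_pos fun i _ => hN i i.2
    have h3 : 0 ≤ ∏ i : {i // b i + ⟪l i, v⟫ = 0}, (b i + ⟪l i, x N⟫) := by
      by_contra hcon
      push Not at hcon
      exact absurd h1 (not_le.2 (mul_neg_of_neg_of_pos hcon h2))
    rw [Finset.prod_congr rfl fun (i : {i // b i + ⟪l i, v⟫ = 0}) _ => hqa i i.2 N,
      Finset.prod_mul_distrib, Finset.prod_const] at h3
    exact (mul_nonneg_iff_of_pos_left (pow_pos (hr0 N) _)).1 h3
  have hcone : Cone l b v d := by
    by_contra hcon
    linarith [hneg d hcon hnd hpd]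
  have hnd' := h.cone_pos hv hcone hd0
  -- second part
  set a : Fin m → ℝ := fun i => if b i + ⟪l i, v⟫ = 0 then ⟪l i, d⟫ else 1 with ha
  have hpos2 : ∀ᶠ N in (hyperfilter ℕ : Filter ℕ), ∀ i, a i ≠ 0 → 0 < b i + ⟪l i, x N⟫ := by
    refine eventually_all.2 fun i => ?_
    by_cases hi : b i + ⟪l i, v⟫ = 0
    · by_cases hi2 : ⟪l i, d⟫ = 0
      · refine Eventually.of_forall fun N hne => absurd ?_ hne
        simp only [ha, if_pos hi, hi2]
      · have h0 := lt_of_le_of_ne (hcone i hi) (Ne.symm hi2)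
        filter_upwards [(hinn (l i)).eventually_const_lt h0] with N hN _
        rw [hqa i hi]
        exact mul_pos (hr0 N) hN
    · filter_upwards [hpos] with N hN _ using hN i hi
  obtain ⟨⟨i, j⟩, hpair⟩ := ultra_pick (hyperfilter ℕ) (κ := Fin m × Fin m)
    (fun p N => p.1 ≠ p.2 ∧ a p.1 = 0 ∧ a p.2 = 0 ∧
      b p.1 + ⟪l p.1, x N⟫ < 0 ∧ b p.2 + ⟪l p.2, x N⟫ ≤ 0) (by
      filter_upwards [hpos2] with N hN
      obtain ⟨i, j, h1⟩ := aux_loc _ _ hN (hprod N) (hout N)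
      exact ⟨(i, j), h1⟩)
  obtain ⟨N0, hij, hai, haj, -, -⟩ := hpair.exists
  have ha0 : ∀ i, a i = 0 → b i + ⟪l i, v⟫ = 0 ∧ ⟪l i, d⟫ = 0 := by
    intro i hi
    simp only [ha] at hi
    split_ifs at hi with h1
    · exact ⟨h1, hi⟩
    · exact absurd hi one_ne_zero
  obtain ⟨hiz, hid⟩ := ha0 i hai
  obtain ⟨hjz, hjd⟩ := ha0 j haj
  have hix : ∀ᶠ N in (hyperfilter ℕ : Filter ℕ), b i + ⟪l i, x N⟫ < 0 := hpair.mono fun N hN => hN.2.2.2.1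
  have hjx : ∀ᶠ N in (hyperfilter ℕ : Filter ℕ), b j + ⟪l j, x N⟫ ≤ 0 := hpair.mono fun N hN => hN.2.2.2.2
  set δ : ℕ → ℝ := fun N => -(b i + ⟪l i, x N⟫) - (b j + ⟪l j, x N⟫) with hδ
  have hδpos : ∀ᶠ N in (hyperfilter ℕ : Filter ℕ), 0 < δ N := by
    filter_upwards [hix, hjx] with N a1 a2
    simp only [hδ]; linarith
  have hεpos : ∀ᶠ N in (hyperfilter ℕ : Filter ℕ), 0 < r N ^ (2 * k v + 1) * δ N := by
    filter_upwards [hδpos] with N a1 using mul_pos (pow_pos (hr0 N) _) a1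
  have hfin := sum_dom hv (fun u N => W l b K u (x N) * f u (x N - u)) (hyperfilter ℕ : Filter ℕ)
    (fun N => r N ^ (2 * k v + 1) * δ N) hεpos
    (W l b K v v / 2 * (c * (⟪n v, d⟫ / 2) ^ (2 * k v + 1))) (by positivity) (by
      filter_upwards [hδpos, hεpos, hix, hjx, hW.eventually_const_le (half_lt_self hWv),
        (hinn (n v)).eventually_const_le (half_lt_self hnd')] with N a1 a2 a3 a4 a5 a6
      have ei := q_sub (l := l) (b := b) i v (x N)
      have ej := q_sub (l := l) (b := b) j v (x N)
      rw [hiz, zero_add] at ei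
      rw [hjz, zero_add] at ej
      have e1 : ⟪n v, x N - v⟫ = r N * ⟪n v, dN N⟫ := by
        nth_rewrite 1 [hyd N]; rw [inner_smul_right]
      have h1 := hlast i j d (x N - v) hij hiz hjz hd0 hcone hid hjd (ei ▸ a3.le) (ej ▸ a4)
        (by rw [e1]; exact mul_pos (hr0 N) (by linarith))
      rw [← ei, ← ej, e1, mul_pow] at h1
      have h2 : (⟪n v, d⟫ / 2) ^ (2 * k v + 1) ≤ ⟪n v, dN N⟫ ^ (2 * k v + 1) :=
        pow_le_pow_left₀ (by positivity) a6 _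
      have h3 : f v (x N - v) ≤ -((c * (⟪n v, d⟫ / 2) ^ (2 * k v + 1)) * (r N ^ (2 * k v + 1) * δ N)) := by
        have := mul_le_mul_of_nonneg_right (mul_le_mul_of_nonneg_left h2 hc.le) a2.le
        simp only [hδ] at this ⊢
        linarith
      have h4 : 0 ≤ (c * (⟪n v, d⟫ / 2) ^ (2 * k v + 1)) * (r N ^ (2 * k v + 1) * δ N) := by positivity
      have h5 := mul_le_mul_of_nonneg_left h3 (W_nonneg (l := l) (b := b) K v (x N))
      have h6 := mul_le_mul_of_nonneg_right a5 h4
      linarith) (by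
      intro u hu huv η hη
      by_cases hboth : b i + ⟪l i, u⟫ = 0 ∧ b j + ⟪l j, u⟫ = 0
      · obtain ⟨c', hc', hcb'⟩ := h.term_nonpos (K := K) hu (hB u hu) hx (h.mem hv)
          huv.symm hij hboth.1 hboth.2 hiz hjz hix hjx
        filter_upwards [hδpos, hcb', hεpos] with N a1 a2 a3
        refine a2.trans ?_
        have h1 := mul_nonneg (mul_nonneg hc'.le (W_nonneg (l := l) (b := b) K u (x N))) a1.le
        have h2 := mul_pos hη a3
        simp only [hδ] at h1 h2 ⊢
        linarith
      · have hF : ∃ F, b F + ⟪l F, v⟫ = 0 ∧ b F + ⟪l F, u⟫ ≠ 0 ∧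
            ∀ᶠ N in (hyperfilter ℕ : Filter ℕ), |b F + ⟪l F, x N⟫| ≤ δ N := by
          by_cases h1 : b i + ⟪l i, u⟫ = 0
          · refine ⟨j, hjz, fun h2 => hboth ⟨h1, h2⟩, ?_⟩
            filter_upwards [hix, hjx] with N a1 a2
            rw [abs_of_nonpos a2]; simp only [hδ]; linarith
          · refine ⟨i, hiz, h1, ?_⟩
            filter_upwards [hix, hjx] with N a1 a2
            rw [abs_of_neg a1]; simp only [hδ]; linarith
        obtain ⟨F, hFv, hF, hFd⟩ := hF
        refine small (hB u hu).2.1 hF hx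
          (s := fun N => ‖l F‖ ^ (2 * K - 1) * r N ^ (2 * K - 1 - (2 * k v + 1))) ?_ hεpos ?_ η hη
        · have := (hrl.pow (2 * K - 1 - (2 * k v + 1))).const_mul (‖l F‖ ^ (2 * K - 1))
          rwa [zero_pow (by omega), mul_zero] at this
        · filter_upwards [hFd] with N a1
          have e : ‖l F‖ ^ (2 * K - 1) * r N ^ (2 * K - 1 - (2 * k v + 1)) * (r N ^ (2 * k v + 1) * δ N)
              = (‖l F‖ * r N) ^ (2 * K - 1) * δ N := by
            rw [mul_pow, ← mul_assoc, mul_assoc (‖l F‖ ^ _) (r N ^ _), ← pow_add,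
              show 2 * K - 1 - (2 * k v + 1) + (2 * k v + 1) = 2 * K - 1 by omega]
          rw [e, ← Even.pow_abs (even_two_mul K)]
          calc |b F + ⟪l F, x N⟫| ^ (2 * K) = |b F + ⟪l F, x N⟫| ^ (2 * K - 1) * |b F + ⟪l F, x N⟫| := by
                rw [← pow_succ, show 2 * K - 1 + 1 = 2 * K by omega]
            _ ≤ _ := mul_le_mul (pow_le_pow_left₀ (abs_nonneg _) (hqb F hFv N) _) a1 (abs_nonneg _)
                (by have := hr0 N; positivity))
  obtain ⟨N, hN⟩ := hfin.exists
  exact absurd (hp N) (not_le.2 hN)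

open Filter Topology in
theorem main (h : PD m V l b n) : ∃ p0 p1 : E 3 → ℝ, IsPF p0 ∧ IsPF p1 ∧
    StrictConcaveOn ℝ univ p0 ∧ (∀ v ∈ V, p0 v = 0) ∧
    ∀ x, x ∈ convexHull ℝ (V : Set (E 3)) ↔
      0 ≤ p0 x ∧ 0 ≤ p1 x ∧ 0 ≤ ∏ i, (b i + ⟪l i, x⟫) := by
  classical
  have hB0 : ∀ v, ∃ (k : ℕ) (f : E 3 → ℝ), IsPF (fun x => f (x - v)) ∧ (v ∈ V → LB l b n v k f) := by
    intro v
    by_cases hv : v ∈ V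
    · obtain ⟨k, f, hf⟩ := h.lemB hv
      exact ⟨k, f, hf.1, fun _ => hf⟩
    · exact ⟨0, fun _ => 0, IsPF.const 0, fun h => absurd h hv⟩
  choose k f hfP hB using hB0
  set K := V.sup k + 2 with hK
  set p1 : E 3 → ℝ := fun x => ∑ v ∈ V, W l b K v x * f v (x - v) with hp1
  have hp1P : IsPF p1 := IsPF.sum V (f := fun v x => W l b K v x * f v (x - v))
    fun v => (W_PF K v).mul (hfP v)
  by_contra hcon
  have hNx : ∀ N : ℕ, ∃ x, (∃ i, b i + ⟪l i, x⟫ < 0) ∧ 0 ≤ p1 x ∧ 0 ≤ ∏ i, (b i + ⟪l i, x⟫) ∧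
      (∀ i, -(1 / ((N : ℝ) + 1)) ≤ b i + ⟪l i, x⟫) ∧
      ∀ v ∈ V, -(1 / ((N : ℝ) + 1)) * ‖x - v‖ ≤ ⟪n v, x - v⟫ := by
    intro N
    obtain ⟨p0, hp0, hp0c, hp0v, hp0P, hp0n⟩ := h.lemA (1 / ((N : ℝ) + 1)) (by positivity)
    by_contra hc
    push Not at hc
    refine hcon ⟨p0, p1, hp0, hp1P, hp0c, hp0v, fun x => ⟨fun hx => ⟨hp0P x hx, ?_, ?_⟩, ?_⟩⟩
    · exact Finset.sum_nonneg fun v hv => mul_nonneg (W_nonneg _ _ _) ((hB v hv).2.2.2.1 _ (h.cone_of_mem hx))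
    · exact Finset.prod_nonneg fun i _ => (h.hP x).1 hx i
    · rintro ⟨h1, h2, h3⟩
      rw [h.hP]
      by_contra hx
      push Not at hx
      obtain ⟨v, hv, hlt⟩ := hc x hx h2 h3 (hp0n x h1).1
      linarith [(hp0n x h1).2 v hv]
  choose x hout hp hprod hq hnn using hNx
  obtain ⟨c, D, hD, hnear⟩ := h.near
  have hcomp : IsCompact (convexHull ℝ (V : Set (E 3))) := V.finite_toSet.isCompact_convexHull ℝ
  choose t ht htm using fun N : ℕ => hnear (1 / ((N : ℝ) + 1)) (x N) (by positivity) (hq N)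
  obtain ⟨z, hz, hzl⟩ := ultra_lim hcomp _ htm
  have ht1 : Tendsto t (hyperfilter ℕ : Filter ℕ) (𝓝 1) := by
    have h1 : Tendsto (fun N : ℕ => D / (D + 1 / ((N : ℝ) + 1))) (hyperfilter ℕ : Filter ℕ) (𝓝 (D / (D + 0))) :=
      Tendsto.div tendsto_const_nhds (hyper_inv.const_add D) (by simpa using hD.ne')
    rw [add_zero, div_self hD.ne'] at h1
    exact h1.congr fun N => (ht N).symm
  have htpos : ∀ N, t N ≠ 0 := fun N => by rw [ht N]; positivity
  have hxl : Tendsto x (hyperfilter ℕ : Filter ℕ) (𝓝 z) := by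
    have h1 := (ht1.inv₀ one_ne_zero).smul (hzl.sub_const c)
    have h2 := h1.const_add c
    simp only [inv_one, one_smul, add_sub_cancel] at h2
    refine h2.congr fun N => ?_
    rw [add_sub_cancel_left, inv_smul_smul₀ (htpos N), add_sub_cancel]
  by_cases hzV : z ∈ V
  · refine h.caseB (K := K) hB hzV ?_ hxl hout (fun N => hnn N z hzV) hprod hp
    have := Finset.le_sup (f := k) hzV
    omega
  · exact h.caseA (K := K) (by omega) hB hz hzV hxl hout hprod hp
end PD

lemma exists_min_V (V : Finset (E 3)) (hV : V.Nonempty) : ∃ V' : Finset (E 3), V'.Nonempty ∧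
    convexHull ℝ (V' : Set (E 3)) = convexHull ℝ (V : Set (E 3)) ∧
    ∀ v ∈ V', v ∉ convexHull ℝ ((V' : Set (E 3)) \ {v}) := by
  classical
  induction V using Finset.strongInduction with
  | H V ih =>
    by_cases h : ∀ v ∈ V, v ∉ convexHull ℝ ((V : Set (E 3)) \ {v})
    · exact ⟨V, hV, rfl, h⟩
    · push Not at h
      obtain ⟨v, hv, hvm⟩ := h
      have e : ((V.erase v : Finset (E 3)) : Set (E 3)) = (V : Set (E 3)) \ {v} := Finset.coe_erase v V
      have hne : (V.erase v).Nonempty := by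
        rw [← Finset.coe_nonempty, e]
        exact convexHull_nonempty_iff.1 ⟨v, hvm⟩
      obtain ⟨V', h1, h2, h3⟩ := ih _ (Finset.erase_ssubset hv) hne
      refine ⟨V', h1, ?_, h3⟩
      rw [h2, e]
      refine Subset.antisymm (convexHull_mono sdiff_subset) (convexHull_min ?_ (convex_convexHull ℝ _))
      intro w hw
      by_cases hwv : w = v
      · rwa [hwv]
      · exact subset_convexHull ℝ _ ⟨hw, hwv⟩

lemma exists_dual (f : E 3 →L[ℝ] ℝ) : ∃ a : E 3, ∀ x, f x = ⟪a, x⟫ :=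
  ⟨(InnerProductSpace.toDual ℝ (E 3)).symm f, fun x => by simp⟩

lemma exists_n (V : Finset (E 3)) (hV : ∀ v ∈ V, v ∉ convexHull ℝ ((V : Set (E 3)) \ {v})) :
    ∃ n : E 3 → E 3, ∀ v ∈ V, ∀ w ∈ V, w ≠ v → 0 < ⟪n v, w - v⟫ ∧ ⟪n v, w - v⟫ ≤ 1 := by
  have : ∀ v, ∃ a : E 3, v ∈ V → ∀ w ∈ V, w ≠ v → 0 < ⟪a, w - v⟫ ∧ ⟪a, w - v⟫ ≤ 1 := by
    intro v
    by_cases hv : v ∈ V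
    · have hcl : IsClosed (convexHull ℝ ((V : Set (E 3)) \ {v})) :=
        (V.finite_toSet.subset sdiff_subset).isClosed_convexHull ℝ
      obtain ⟨f, s, h1, h2⟩ := geometric_hahn_banach_point_closed (convex_convexHull ℝ _) hcl (hV v hv)
      obtain ⟨a, ha⟩ := exists_dual f
      obtain ⟨ε, hε, hεb⟩ := exists_scale (fun w : V => ⟪a, (w : E 3) - v⟫)
      refine ⟨ε • a, fun _ w hw hwv => ?_⟩
      have h3 := h2 w (subset_convexHull ℝ _ ⟨hw, hwv⟩)
      rw [ha] at h1 h3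
      rw [inner_smul_left]
      refine ⟨mul_pos hε ?_, hεb ⟨w, hw⟩⟩
      rw [inner_sub_right]; linarith
    · exact ⟨0, fun h => absurd h hv⟩
  choose n hn using this
  exact ⟨n, hn⟩

lemma suppF_eq {P : Set (E 3)} {u x : E 3} (hx : x ∈ P) (h : ∀ y ∈ P, ⟪u, y⟫ ≤ ⟪u, x⟫) :
    suppF P u = ⟪u, x⟫ := by
  apply IsGreatest.csSup_eq
  refine ⟨⟨x, hx, rfl⟩, ?_⟩
  rintro _ ⟨y, hy, rfl⟩
  exact h y hy

lemma le_suppF {P : Set (E 3)} (hP : IsCompact P) (u : E 3) {x : E 3} (hx : x ∈ P) :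
    ⟪u, x⟫ ≤ suppF P u := by
  refine le_csSup ?_ (mem_image_of_mem (fun x => ⟪u, x⟫) hx)
  exact (hP.image (f := fun x => ⟪u, x⟫) (by fun_prop)).bddAbove

lemma lt_suppF {P : Set (E 3)} (hP : IsCompact P) {u : E 3} (hu : ‖u‖ = 1) {c : E 3}
    (hc : c ∈ interior P) : ⟪u, c⟫ < suppF P u := by
  obtain ⟨ε, hε, hb⟩ := Metric.isOpen_iff.1 isOpen_interior c hc
  have h1 : c + (ε / 2) • u ∈ P := by
    apply interior_subset
    apply hb
    rw [mem_ball, dist_eq_norm, add_sub_cancel_left, norm_smul, hu, mul_one, Real.norm_eq_abs,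
      abs_of_pos (by positivity)]
    linarith
  have := le_suppF hP u h1
  rw [inner_add_right, inner_smul_right, real_inner_self_eq_norm_sq, hu] at this
  linarith

lemma facet_normal {P : Set (E 3)} (hdim : dimS P = 3) {G : Set (E 3)} (hG : IsFacetOf P G) :
    ‖outerNormal P G‖ = 1 ∧ exposedSet P (outerNormal P G) = G ∧ dimS G = 2 := by
  have hd2 : dimS G = 2 := by have := hG.2; omega
  have hne : G.Nonempty := by
    by_contra h
    rw [not_nonempty_iff_eq_empty] at h
    rw [h, dimS, AffineSubspace.span_empty, AffineSubspace.direction_bot, finrank_bot] at hd2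
    omega
  obtain ⟨f, hf⟩ := hG.1 hne
  obtain ⟨a, ha⟩ := exists_dual f
  have ha0 : a ≠ 0 := by
    rintro rfl
    have : G = P := by
      rw [hf]; ext x; simp [ha]
    rw [this] at hd2
    omega
  have hna : 0 < ‖a‖ := norm_pos_iff.2 ha0
  have htop : (affineSpan ℝ P).direction = ⊤ := by
    apply Submodule.eq_top_of_finrank_eq
    rw [finrank_euclideanSpace_fin]; exact hdim
  have hex : ∃ u : E 3, u ∈ (affineSpan ℝ P).direction ∧ ‖u‖ = 1 ∧ exposedSet P u = G := by
    refine ⟨‖a‖⁻¹ • a, by rw [htop]; trivial, ?_, ?_⟩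
    · rw [norm_smul, norm_inv, norm_norm, inv_mul_cancel₀ hna.ne']
    · obtain ⟨x0, hx0⟩ := hne
      have hx0' := hx0
      rw [hf] at hx0'
      have hs : ∀ y, ⟪‖a‖⁻¹ • a, y⟫ = ‖a‖⁻¹ * f y := fun y => by
        rw [ha, inner_smul_left]; rfl
      have hle : ∀ y z, ‖a‖⁻¹ * f y ≤ ‖a‖⁻¹ * f z ↔ f y ≤ f z := fun y z =>
        mul_le_mul_iff_right₀ (inv_pos.2 hna)
      have h1 : suppF P (‖a‖⁻¹ • a) = ‖a‖⁻¹ * f x0 := by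
        rw [suppF_eq hx0'.1 fun y hy => ?_, hs]
        rw [hs, hs, hle]
        exact hx0'.2 y hy
      rw [hf]
      ext x
      simp only [exposedSet, mem_ofPred_eq, h1, hs]
      refine and_congr_right fun hx => ⟨fun e y hy => ?_, fun h => ?_⟩
      · rw [← hle, e, hle]; exact hx0'.2 y hy
      · exact le_antisymm ((hle _ _).2 (hx0'.2 x hx)) ((hle _ _).2 (h x0 hx0'.1))
  exact ⟨(Classical.epsilon_spec hex).2.1, (Classical.epsilon_spec hex).2.2, hd2⟩

open MeasureTheory in
lemma exists_avoid (V : Finset (E 3)) (x : E 3) {O : Set (E 3)} (hO : IsOpen O) (hne : O.Nonempty) :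
    ∃ c ∈ O, ∀ v ∈ V, ∀ w ∈ V, c ∉ affineSpan ℝ ({x, v, w} : Set (E 3)) := by
  by_contra hcon
  push Not at hcon
  have hsub : O ⊆ ⋃ v ∈ V, ⋃ w ∈ V, (affineSpan ℝ ({x, v, w} : Set (E 3)) : Set (E 3)) := by
    intro c hc
    obtain ⟨v, hv, w, hw, h⟩ := hcon c hc
    simp only [mem_iUnion]
    exact ⟨v, hv, w, hw, h⟩
  have h0 : volume (⋃ v ∈ V, ⋃ w ∈ V, (affineSpan ℝ ({x, v, w} : Set (E 3)) : Set (E 3))) = 0 := by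
    refine (measure_biUnion_null_iff V.countable_toSet).2 fun v _ =>
      (measure_biUnion_null_iff V.countable_toSet).2 fun w _ => ?_
    apply Measure.addHaar_affineSubspace
    intro htop
    have h1 := (coplanar_triple ℝ x v w).finrank_le_two
    rw [← direction_affineSpan, htop, AffineSubspace.direction_top, finrank_top,
      finrank_euclideanSpace_fin] at h1
    omega
  have h1 := hO.measure_pos volume hne
  exact absurd (measure_mono_null hsub h0) h1.ne'

open Filter Topology in
lemma exists_bdry {P : Set (E 3)} (hP : IsCompact P) {c x : E 3} (hc : c ∈ interior P) (hx : x ∉ P) :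
    ∃ t : ℝ, 0 < t ∧ t < 1 ∧ c + t • (x - c) ∈ P ∧ c + t • (x - c) ∉ interior P := by
  set g : ℝ → E 3 := fun t => c + t • (x - c) with hg
  have hgc : Continuous g := by simp only [hg]; fun_prop
  have hS : IsCompact (Icc (0:ℝ) 1 ∩ g ⁻¹' P) := isCompact_Icc.inter_right (hP.isClosed.preimage hgc)
  have h0 : g 0 = c := by simp [hg]
  have h1 : g 1 = x := by simp [hg]
  obtain ⟨t, ⟨⟨ht0, ht1⟩, htP⟩, hmax⟩ := hS.exists_isMaxOn (f := id)
    ⟨0, ⟨le_refl _, zero_le_one⟩, by rw [mem_preimage, h0]; exact interior_subset hc⟩ continuousOn_id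
  have ht1' : t < 1 := lt_of_le_of_ne ht1 fun e => hx (by rw [← h1, ← e]; exact htP)
  have hni : g t ∉ interior P := by
    intro hin
    have h2 : ∀ᶠ s in 𝓝 t, g s ∈ interior P := hgc.continuousAt.eventually (isOpen_interior.mem_nhds hin)
    have h3 : ∀ᶠ s in 𝓝[>] t, g s ∈ interior P ∧ s < 1 :=
      nhdsWithin_le_nhds (h2.and (gt_mem_nhds ht1'))
    obtain ⟨s, ⟨hs1, hs2⟩, hs3⟩ := (h3.and self_mem_nhdsWithin).exists
    have hs3 : t < s := hs3
    have := hmax (show s ∈ Icc (0:ℝ) 1 ∩ g ⁻¹' P from ⟨⟨by linarith, hs2.le⟩, interior_subset (s := P) hs1⟩)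
    simp only [mem_ofPred_eq, id] at this
    linarith
  refine ⟨t, lt_of_le_of_ne ht0 fun e => hni (by rw [← e, h0]; exact hc), ht1', htP, hni⟩

open Filter Topology in
lemma facet_sep (V : Finset (E 3)) (hint : (interior (convexHull ℝ (V : Set (E 3)))).Nonempty)
    {x : E 3} (hx : x ∉ convexHull ℝ (V : Set (E 3))) :
    ∃ (G : Set (E 3)) (c : E 3) (t : ℝ), IsExposed ℝ (convexHull ℝ (V : Set (E 3))) G ∧ dimS G = 2 ∧
      c ∈ interior (convexHull ℝ (V : Set (E 3))) ∧ 0 < t ∧ t < 1 ∧ c + t • (x - c) ∈ G := by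
  classical
  set P := convexHull ℝ (V : Set (E 3)) with hPdef
  have hconv : Convex ℝ P := convex_convexHull ℝ _
  have hcomp : IsCompact P := V.finite_toSet.isCompact_convexHull ℝ
  obtain ⟨c, hc, hav⟩ := exists_avoid V x isOpen_interior hint
  obtain ⟨t, ht0, ht1, hzP, hzi⟩ := exists_bdry hcomp hc hx
  set z := c + t • (x - c) with hz
  obtain ⟨f, hf⟩ := geometric_hahn_banach_open_point hconv.interior isOpen_interior hzi
  have hle : ∀ a ∈ P, f a ≤ f z := by
    intro a ha
    have h1 : a ∈ closure (interior P) := by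
      rw [hconv.closure_interior_eq_closure_of_nonempty_interior hint]
      exact subset_closure ha
    exact closure_minimal (t := {a | f a ≤ f z}) (fun y hy => (hf y hy).le)
      (isClosed_le f.continuous continuous_const) h1
  set G : Set (E 3) := {y ∈ P | ∀ w ∈ P, f w ≤ f y} with hG
  have hGz : ∀ y ∈ G, f y = f z := fun y hy => le_antisymm (hle y hy.1) (hy.2 z hzP)
  have hzG : z ∈ G := ⟨hzP, hle⟩
  refine ⟨G, c, t, fun _ => ⟨f, rfl⟩, ?_, hc, ht0, ht1, hzG⟩
  obtain ⟨w, hw, hw1, hwz⟩ := Finset.mem_convexHull'.1 hzP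
  set H : Set (E 3) := {v | v ∈ V ∧ f v = f z} with hH
  have hHG : H ⊆ G := fun v hv => ⟨subset_convexHull ℝ _ hv.1, fun y hy => by rw [hv.2]; exact hle y hy⟩
  have hwH : ∀ v ∈ V, w v ≠ 0 → v ∈ H := by
    intro v hv hne
    refine ⟨hv, ?_⟩
    have h1 : ∑ y ∈ V, w y * (f z - f y) = 0 := by
      simp only [mul_sub, Finset.sum_sub_distrib, ← Finset.sum_mul, hw1, one_mul]
      rw [sub_eq_zero]
      nth_rewrite 1 [← hwz]
      simp
    have h2 := (Finset.sum_eq_zero_iff_of_nonneg (fun y hy => mul_nonneg (hw y hy)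
      (sub_nonneg.2 (hle y (subset_convexHull ℝ _ hy))))).1 h1 v hv
    have := (mul_eq_zero.1 h2).resolve_left hne
    linarith
  have hzH : z ∈ convexHull ℝ H := by
    have e : ∑ y ∈ V.filter (fun v => w v ≠ 0), w y = 1 := by
      rw [← hw1]; exact Finset.sum_filter_ne_zero V
    have hz' : z = ∑ y ∈ V.filter (fun v => w v ≠ 0), w y • y := by
      rw [← hwz, Finset.sum_filter]
      refine Finset.sum_congr rfl fun y _ => ?_
      split_ifs with h
      · rfl
      · rw [not_not.1 h, zero_smul]
    rw [hz']
    exact (convex_convexHull ℝ H).sum_mem (fun y hy => hw y (Finset.mem_filter.1 hy).1) e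
      (fun y hy => subset_convexHull ℝ _ (hwH y (Finset.mem_filter.1 hy).1 (Finset.mem_filter.1 hy).2))
  have hzA : z ∈ affineSpan ℝ H := convexHull_subset_affineSpan H hzH
  have hnc : ¬ Collinear ℝ H := by
    intro hcol
    obtain ⟨v, hv⟩ := convexHull_nonempty_iff.1 ⟨z, hzH⟩
    have : ∃ v' ∈ H, affineSpan ℝ H ≤ affineSpan ℝ {v, v'} := by
      by_cases h : ∃ v' ∈ H, v ≠ v'
      · obtain ⟨v', hv', hne⟩ := h
        exact ⟨v', hv', (hcol.affineSpan_eq_of_ne hv hv' hne).ge⟩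
      · push Not at h
        exact ⟨v, hv, affineSpan_mono ℝ fun y hy => by rw [← h y hy]; simp⟩
    obtain ⟨v', hv', hle'⟩ := this
    have hz2 : z ∈ affineSpan ℝ ({x, v, v'} : Set (E 3)) :=
      affineSpan_mono ℝ (subset_insert _ _) (hle' hzA)
    have hx2 : x ∈ affineSpan ℝ ({x, v, v'} : Set (E 3)) := subset_affineSpan ℝ _ (mem_insert _ _)
    have hc2 := AffineMap.lineMap_mem (1 - t)⁻¹ hx2 hz2
    refine hav v hv.1 v' hv'.1 ?_
    convert! hc2 using 1
    rw [AffineMap.lineMap_apply_module', hz]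
    have : c + t • (x - c) - x = (1 - t) • (c - x) := by module
    rw [this, inv_smul_smul₀ (by linarith)]
    module
  have hlow : 2 ≤ dimS G := by
    rw [collinear_iff_finrank_le_one] at hnc
    have : Module.finrank ℝ (vectorSpan ℝ H) ≤ dimS G := by
      rw [dimS, direction_affineSpan]
      exact Submodule.finrank_mono (vectorSpan_mono ℝ hHG)
    omega
  have hup : dimS G ≤ 2 := by
    have h1 : vectorSpan ℝ G ≤ LinearMap.ker (f : E 3 →ₗ[ℝ] ℝ) := by
      rw [vectorSpan, Submodule.span_le]
      rintro _ ⟨a, ha, b, hb, rfl⟩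
      simp [hGz a ha, hGz b hb]
    have h2 : LinearMap.ker (f : E 3 →ₗ[ℝ] ℝ) < ⊤ := by
      rw [lt_top_iff_ne_top]
      intro htop
      have : ∀ y, f y = 0 := fun y => LinearMap.mem_ker.1 (htop ▸ Submodule.mem_top : y ∈ LinearMap.ker (f : E 3 →ₗ[ℝ] ℝ))
      have := hf c hc
      simp_all
    have h3 := Submodule.finrank_lt_finrank_of_lt h2
    rw [finrank_top, finrank_euclideanSpace_fin] at h3
    have h4 := Submodule.finrank_mono h1
    rw [dimS, direction_affineSpan]
    omega
  omega

lemma ker_one {a b : E 3} (hab : LinearIndependent ℝ ![a, b]) {d y : E 3} (hd : d ≠ 0)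
    (had : ⟪a, d⟫ = 0) (hbd : ⟪b, d⟫ = 0) (hay : ⟪a, y⟫ = 0) (hby : ⟪b, y⟫ = 0) :
    ∃ t : ℝ, y = t • d := by
  set S := Submodule.span ℝ (Set.range ![a, b]) with hS
  have h1 : Module.finrank ℝ S = 2 := by
    rw [hS, finrank_span_eq_card hab]; simp
  have h2 := Submodule.finrank_add_finrank_orthogonal S
  rw [h1, finrank_euclideanSpace_fin] at h2
  have h3 : Module.finrank ℝ Sᗮ = 1 := by omega
  have hm : ∀ e : E 3, ⟪a, e⟫ = 0 → ⟪b, e⟫ = 0 → e ∈ Sᗮ := by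
    intro e h1 h2
    rw [hS, Submodule.mem_orthogonal]
    intro w hw
    simp only [Matrix.range_cons, Matrix.range_empty, union_empty, singleton_union] at hw
    obtain ⟨α, β, rfl⟩ := Submodule.mem_span_pair.1 hw
    rw [inner_add_left, inner_smul_left, inner_smul_left, h1, h2]; simp
  obtain ⟨t, ht⟩ := (finrank_eq_one_iff_of_nonzero' (⟨d, hm d had hbd⟩ : Sᗮ)
    (by intro e; exact hd (congrArg Subtype.val e))).1 h3 ⟨y, hm y hay hby⟩
  exact ⟨t, (congrArg Subtype.val ht).symm⟩

lemma mem_comb {a b e s : E 3} (hab : LinearIndependent ℝ ![a, b]) (hs : s ≠ 0)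
    (ha : ⟪a, s⟫ = 0) (hb : ⟪b, s⟫ = 0) (he : ⟪e, s⟫ = 0) : ∃ α β : ℝ, e = α • a + β • b := by
  set S := Submodule.span ℝ (Set.range ![a, b]) with hS
  have h1 : Module.finrank ℝ S = 2 := by
    rw [hS, finrank_span_eq_card hab]; simp
  have h2 := Submodule.finrank_add_finrank_orthogonal (Submodule.span ℝ {s})
  rw [finrank_span_singleton hs, finrank_euclideanSpace_fin] at h2
  have hle : S ≤ (Submodule.span ℝ {s})ᗮ := by
    rw [hS, Submodule.span_le]
    rintro _ ⟨i, rfl⟩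
    rw [SetLike.mem_coe, Submodule.mem_orthogonal_singleton_iff_inner_left]
    fin_cases i
    · exact ha
    · exact hb
  have heq := Submodule.eq_of_le_of_finrank_eq hle (by omega)
  have hm : e ∈ S := by
    rw [heq, Submodule.mem_orthogonal_singleton_iff_inner_left]; exact he
  simp only [hS, Matrix.range_cons, Matrix.range_empty, union_empty, singleton_union] at hm
  obtain ⟨α, β, h⟩ := Submodule.mem_span_pair.1 hm
  exact ⟨α, β, h.symm⟩

/-- facet data -/
structure FD (m : ℕ) (P : Set (E 3)) (F : Fin m → Set (E 3)) (u : Fin m → E 3) (c : E 3) : Prop where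
  comp : IsCompact P
  inj : Function.Injective F
  nu : ∀ i, ‖u i‖ = 1
  ex : ∀ i, exposedSet P (u i) = F i
  dim : ∀ i, dimS (F i) = 2
  hc : ∀ i, ⟪u i, c⟫ < suppF P (u i)

namespace FD
variable {m : ℕ} {P : Set (E 3)} {F : Fin m → Set (E 3)} {u : Fin m → E 3} {c : E 3}

lemma indep (h : FD m P F u c) {i j : Fin m} (hij : i ≠ j) {z : E 3}
    (hi : suppF P (u i) = ⟪u i, z⟫) (hj : suppF P (u j) = ⟪u j, z⟫) :
    LinearIndependent ℝ ![u i, u j] := by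
  have h0 : u i ≠ 0 := by
    intro e; have := h.nu i; rw [e, norm_zero] at this; exact zero_ne_one this
  rw [LinearIndependent.pair_iff' h0]
  intro a ha
  have h1 : |a| = 1 := by
    have := h.nu j
    rwa [← ha, norm_smul, h.nu i, mul_one, Real.norm_eq_abs] at this
  rcases (abs_eq zero_le_one).1 h1 with rfl | rfl
  · rw [one_smul] at ha
    exact hij (h.inj (by rw [← h.ex i, ← h.ex j, ha]))
  · have e : u j = - u i := by rw [← ha]; simp
    have h2 := h.hc i
    have h3 := h.hc j
    rw [hi] at h2
    rw [hj, e, inner_neg_left, inner_neg_left] at h3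
    linarith

lemma irrX (h : FD m P F u c) {i j k : Fin m} (hij : i ≠ j) (hik : i ≠ k) (hjk : j ≠ k) {z s : E 3}
    (hi : suppF P (u i) = ⟪u i, z⟫) (hj : suppF P (u j) = ⟪u j, z⟫) (hk : suppF P (u k) = ⟪u k, z⟫)
    (hs : s ≠ 0) (his : ⟪u i, s⟫ = 0) (hjs : ⟪u j, s⟫ = 0)
    {α β : ℝ} (hα : 0 ≤ α) (hβ : 0 ≤ β) (he : u k = α • u i + β • u j) : False := by
  have hα' : 0 < α := by
    refine lt_of_le_of_ne hα fun e => ?_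
    rw [← e, zero_smul, zero_add] at he
    have hI := h.indep hjk hj hk
    have h0 : u j ≠ 0 := by
      intro e; have := h.nu j; rw [e, norm_zero] at this; exact zero_ne_one this
    exact (LinearIndependent.pair_iff' h0).1 hI β he.symm
  have hβ' : 0 < β := by
    refine lt_of_le_of_ne hβ fun e => ?_
    rw [← e, zero_smul, add_zero] at he
    have hI := h.indep hik hi hk
    have h0 : u i ≠ 0 := by
      intro e; have := h.nu i; rw [e, norm_zero] at this; exact zero_ne_one this
    exact (LinearIndependent.pair_iff' h0).1 hI α he.symm
  have hsub : vectorSpan ℝ (F k) ≤ Submodule.span ℝ {s} := by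
    have hy : ∀ y ∈ F k, ⟪u i, y - z⟫ = 0 ∧ ⟪u j, y - z⟫ = 0 := by
      intro y hy
      rw [← h.ex k] at hy
      have h1 := hy.2
      have h2 := le_suppF h.comp (u i) hy.1
      have h3 := le_suppF h.comp (u j) hy.1
      rw [hi] at h2
      rw [hj] at h3
      rw [hk, he, inner_add_left, inner_add_left, inner_smul_left, inner_smul_left, inner_smul_left,
        inner_smul_left] at h1
      simp only [conj_trivial] at h1
      rw [inner_sub_right, inner_sub_right]
      constructor <;> nlinarith
    rw [vectorSpan, Submodule.span_le]
    rintro _ ⟨a, ha, b, hb, rfl⟩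
    obtain ⟨a1, a2⟩ := hy a ha
    obtain ⟨b1, b2⟩ := hy b hb
    obtain ⟨t, ht⟩ := ker_one (h.indep hij hi hj) hs his hjs (y := a - b)
      (by rw [show a - b = (a - z) - (b - z) by abel, inner_sub_right, a1, b1, sub_zero])
      (by rw [show a - b = (a - z) - (b - z) by abel, inner_sub_right, a2, b2, sub_zero])
    exact Submodule.mem_span_singleton.2 ⟨t, ht.symm⟩
  have h1 := Submodule.finrank_mono hsub
  rw [finrank_span_singleton hs, ← direction_affineSpan] at h1
  have := h.dim k
  rw [dimS] at this
  omega

lemma irr (h : FD m P F u c) {i j k : Fin m} (hij : i ≠ j) (hik : i ≠ k) (hjk : j ≠ k) {z s : E 3}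
    (hi : suppF P (u i) = ⟪u i, z⟫) (hj : suppF P (u j) = ⟪u j, z⟫) (hk : suppF P (u k) = ⟪u k, z⟫)
    (hs : s ≠ 0) (his : ⟪u i, s⟫ = 0) (hjs : ⟪u j, s⟫ = 0) (hks : ⟪u k, s⟫ = 0) : False := by
  obtain ⟨α, β, he⟩ := mem_comb (h.indep hij hi hj) hs his hjs hks
  have ci := h.hc i
  have cj := h.hc j
  have ck := h.hc k
  rw [hi] at ci
  rw [hj] at cj
  rw [hk, he, inner_add_left, inner_add_left, inner_smul_left, inner_smul_left, inner_smul_left,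
        inner_smul_left] at ck
  simp only [conj_trivial] at ck
  rcases lt_or_ge 0 α with hα | hα <;> rcases lt_or_ge 0 β with hβ | hβ
  · exact h.irrX hij hik hjk hi hj hk hs his hjs hα.le hβ.le he
  · refine h.irrX hjk.symm hik.symm hij.symm hk hj hi hs hks hjs (α := α⁻¹) (β := α⁻¹ * -β)
      (inv_pos.2 hα).le (mul_nonneg (inv_pos.2 hα).le (by linarith)) ?_
    rw [he, smul_add, smul_smul, smul_smul, inv_mul_cancel₀ hα.ne', one_smul, add_assoc, ← add_smul]
    simp
  · refine h.irrX hik.symm hjk.symm hij hk hi hj hs hks his (α := β⁻¹) (β := β⁻¹ * -α)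
      (inv_pos.2 hβ).le (mul_nonneg (inv_pos.2 hβ).le (by linarith)) ?_
    rw [he, smul_add, smul_smul, smul_smul, inv_mul_cancel₀ hβ.ne', one_smul]
    module
  · nlinarith
end FD

theorem three_polytope_three_polynomials
    (P : Set (E 3)) (hP : IsPolytope P) (hdim : dimS P = 3)
    (m : ℕ) (F : Fin m → Set (E 3)) (hinj : Function.Injective F)
    (hfacet : ∀ i, IsFacetOf P (F i)) (hall : ∀ G, IsFacetOf P G → ∃ i, F i = G) :
    ∃ p₀ p₁ p₂ : MvPolynomial (Fin 3) ℝ,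
      StrictConcaveOn ℝ Set.univ (evalPoly p₀) ∧
      (∀ v : E 3, IsVertexOf P v → evalPoly p₀ v = 0) ∧
      (∀ x : E 3, evalPoly p₂ x = ∏ i, qF P (F i) x) ∧
      P = {x : E 3 | 0 ≤ evalPoly p₀ x ∧ 0 ≤ evalPoly p₁ x ∧ 0 ≤ evalPoly p₂ x} := by
  classical
  obtain ⟨V0, hV0, hPV0⟩ := hP
  obtain ⟨V, hVne, hVV0, hVmin⟩ := exists_min_V V0 hV0
  have hPV : P = convexHull ℝ (V : Set (E 3)) := hPV0.trans hVV0.symm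
  obtain ⟨n, hn⟩ := exists_n V hVmin
  have hcomp : IsCompact P := hPV ▸ V.finite_toSet.isCompact_convexHull ℝ
  have hconv : Convex ℝ P := hPV ▸ convex_convexHull ℝ _
  have hPne : P.Nonempty := by
    rw [hPV]; exact convexHull_nonempty_iff.2 (Finset.coe_nonempty.2 hVne)
  have htop : affineSpan ℝ P = ⊤ := by
    apply (AffineSubspace.direction_eq_top_iff_of_nonempty ((affineSpan_nonempty ℝ).2 hPne)).1
    apply Submodule.eq_top_of_finrank_eq
    rw [finrank_euclideanSpace_fin]; exact hdim
  have hint : (interior P).Nonempty := (hconv.interior_nonempty_iff_affineSpan_eq_top).2 htop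
  obtain ⟨c, hc⟩ := hint
  have hD : 0 < Metric.diam P := by
    refine lt_of_le_of_ne Metric.diam_nonneg fun e => ?_
    have hsub : P.Subsingleton := fun x hx y hy =>
      dist_le_zero.1 (e ▸ Metric.dist_le_diam_of_mem hcomp.isBounded hx hy)
    have h1 : vectorSpan ℝ P = ⊥ := vectorSpan_of_subsingleton ℝ hsub
    rw [dimS, direction_affineSpan, h1, finrank_bot] at hdim
    omega
  set u : Fin m → E 3 := fun i => outerNormal P (F i) with hu
  have hfd : FD m P F u c :=
    { comp := hcomp
      inj := hinj
      nu := fun i => (facet_normal hdim (hfacet i)).1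
      ex := fun i => (facet_normal hdim (hfacet i)).2.1
      dim := fun i => (facet_normal hdim (hfacet i)).2.2
      hc := fun i => lt_suppF hcomp (facet_normal hdim (hfacet i)).1 hc }
  set l : Fin m → E 3 := fun i => (-(Metric.diam P)⁻¹) • u i with hl
  set b : Fin m → ℝ := fun i => suppF P (u i) / Metric.diam P with hb
  have hli : ∀ i y, ⟪l i, y⟫ = -(Metric.diam P)⁻¹ * ⟪u i, y⟫ := fun i y => by
    simp only [hl]; rw [inner_smul_left]; rfl
  have hq : ∀ i x, b i + ⟪l i, x⟫ = (suppF P (u i) - ⟪u i, x⟫) / Metric.diam P := fun i x => by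
    rw [hli]; simp only [hb]; field_simp; ring
  have hq0 : ∀ i x, b i + ⟪l i, x⟫ = 0 → suppF P (u i) = ⟪u i, x⟫ := fun i x h => by
    rw [hq, div_eq_zero_iff] at h
    exact sub_eq_zero.1 (h.resolve_right hD.ne')
  have hl0 : ∀ i y, ⟪l i, y⟫ = 0 → ⟪u i, y⟫ = 0 := fun i y h => by
    rw [hli] at h
    exact (mul_eq_zero.1 h).resolve_left (neg_ne_zero.2 (inv_ne_zero hD.ne'))
  have hpd : PD m V l b n :=
    { hV := hVne
      hP := by
        intro x
        rw [← hPV]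
        constructor
        · intro hx i
          rw [hq]
          exact div_nonneg (sub_nonneg.2 (le_suppF hcomp _ hx)) hD.le
        · intro hx
          by_contra hxP
          obtain ⟨G, c', t, hG, hGd, hc', ht0, ht1, hz⟩ := facet_sep V (hPV ▸ ⟨c, hc⟩) (hPV ▸ hxP)
          rw [← hPV] at hG hc'
          obtain ⟨i, hi⟩ := hall G ⟨hG, by rw [hGd, hdim]⟩
          have h1 := lt_suppF hcomp (hfd.nu i) hc'
          rw [← hi, ← hfd.ex i] at hz
          have h2 := hz.2
          rw [inner_add_right, inner_smul_right, inner_sub_right] at h2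
          have h3 := hx i
          rw [hq, le_div_iff₀ hD, zero_mul] at h3
          nlinarith
      hc := ⟨c, fun i => by rw [hq]; exact div_pos (sub_pos.2 (hfd.hc i)) hD⟩
      ind := fun i j z d y hij _ hi hj hd hid hjd hiy hjy =>
        ker_one (hfd.indep hij (hq0 i z hi) (hq0 j z hj)) hd (hl0 _ _ hid) (hl0 _ _ hjd)
          (hl0 _ _ hiy) (hl0 _ _ hjy)
      irr := fun i j k z s hij hik hjk _ hi hj hk hs his hjs hks =>
        hfd.irr hij hik hjk (hq0 i z hi) (hq0 j z hj) (hq0 k z hk) hs (hl0 _ _ his) (hl0 _ _ hjs)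
          (hl0 _ _ hks)
      hn := hn }
  obtain ⟨p0, p1, ⟨P0, hP0⟩, ⟨P1, hP1⟩, hconc, hvan, hmem⟩ := hpd.main
  obtain ⟨P2, hP2⟩ := IsPF.prod Finset.univ (f := fun (i : Fin m) x => b i + ⟪l i, x⟫)
    fun i => (IsPF.const (b i)).add (IsPF.inner (l i))
  refine ⟨P0, P1, P2, ?_, ?_, ?_, ?_⟩
  · rw [show evalPoly P0 = p0 from funext hP0]; exact hconc
  · intro v hv
    rw [hP0]
    apply hvan
    have h1 : v ∈ P.extremePoints ℝ := by
      have := IsExposed.isExtreme hv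
      exact isExtreme_singleton.1 this
    rw [hPV] at h1
    exact extremePoints_convexHull_subset h1
  · intro x
    rw [hP2]
    exact Finset.prod_congr rfl fun i _ => hq i x
  · ext x
    rw [mem_ofPred_eq, hP0, hP1, hP2]
    conv_lhs => rw [hPV]
    exact hmem x
end
end

section
/- Let P be a polytope in ℝ^d of dimension d−1 with o ∉ aff P. Then there exists a sequence (g_l)_{l=1}^∞ of polynomials in ℝ[x₁,…,x_d] satisfying 𝒜(P), ℐ(P), 𝒞(P), and additionally ℋ(P): for every l, {x ∈ ℝ^d : g̃_l(x) ≥ 0 and ⟨x,u⟩ ≥ 0} = cone({x ∈ aff P : g_l(x) ≥ 0}), where u ∈ ℝ^d \ {o} is the vector with aff P = {x : ⟨x,u⟩ = 1} and g̃_l is the homogeneous continuation of g_l|_{aff P}. -/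
open scoped RealInnerProductSpace Pointwise
open Metric Set

noncomputable section

/-- The homogeneous continuation of f|_H to ℝ^d, where H = {x : ⟨x,u⟩ = 1}:
a homogeneous polynomial g of degree n = deg f with
g(x) = ⟨x,u⟩ⁿ f(x/⟨x,u⟩) whenever ⟨x,u⟩ ≠ 0. -/
def IsHomContinuation {d : ℕ} (u : E d) (f g : MvPolynomial (Fin d) ℝ) : Prop :=
  g.IsHomogeneous f.totalDegree ∧
  ∀ x : E d, ⟪x, u⟫ ≠ 0 →
    evalPoly g x = ⟪x, u⟫ ^ f.totalDegree * evalPoly f ((⟪x, u⟫)⁻¹ • x)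

lemma aux_sep {d : ℕ} (u : E d) (W : Finset (E d)) (hW : ∀ w ∈ W, ⟪w, u⟫ = 1) (y : E d)
    (hy : ⟪y, u⟫ = 1) (hyW : y ∉ convexHull ℝ (W : Set (E d))) :
    ∃ a : E d, (∀ w ∈ W, |⟪a, w⟫| < 1) ∧ 1 < ⟪a, y⟫ := by
  obtain ⟨f, s, hf, hs⟩ := geometric_hahn_banach_closed_point (convex_convexHull ℝ (W : Set (E d)))
    (W.finite_toSet.isClosed_convexHull ℝ) hyW
  obtain ⟨φ, rfl⟩ := (InnerProductSpace.toDual ℝ (E d)).surjective f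
  simp only [InnerProductSpace.toDual_apply_apply] at hf hs
  obtain ⟨m, hm, hms⟩ : ∃ m : ℝ, (∀ w ∈ W, m < ⟪φ, w⟫) ∧ m < s := by
    obtain ⟨m0, hm0⟩ := (W.image (fun w => ⟪φ, w⟫)).bddBelow
    refine ⟨min m0 s - 1, fun w hw => ?_, ?_⟩
    · have := hm0 (Finset.mem_coe.2 (Finset.mem_image_of_mem _ hw))
      have := min_le_left m0 s
      linarith
    · have := min_le_right m0 s
      linarith
  have hpos : 0 < s - m := by linarith
  have key : ∀ x : E d, ⟪x, u⟫ = 1 → ⟪(s - m)⁻¹ • (φ - m • u), x⟫ = (⟪φ, x⟫ - m) / (s - m) := by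
    intro x hx
    rw [real_inner_smul_left, inner_sub_left, real_inner_smul_left, real_inner_comm x u, hx]
    field_simp
  refine ⟨(s - m)⁻¹ • (φ - m • u), fun w hw => ?_, ?_⟩
  · rw [key w (hW w hw)]
    have h1 := hf w (subset_convexHull ℝ _ hw)
    have h2 := hm w hw
    rw [abs_of_pos (div_pos (by linarith) hpos), div_lt_one hpos]
    linarith
  · rw [key y hy, one_lt_div hpos]
    linarith

lemma aux_lim {n : Type*} [Fintype n] [DecidableEq n] (M : ℕ → Matrix n n ℝ) (r : ℕ → n → ℝ)
    (hM : Filter.Tendsto M Filter.atTop (nhds 1)) (hr : Filter.Tendsto r Filter.atTop (nhds 1)) :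
    ∀ᶠ k in Filter.atTop, ∃ c : n → ℝ, (∀ v, 0 < c v) ∧ (M k).mulVec c = r k := by
  have hdet : Filter.Tendsto (fun k => (M k).det) Filter.atTop (nhds 1) := by
    have hcont : Continuous fun A : Matrix n n ℝ => A.det := continuous_id.matrix_det
    have := (hcont.tendsto 1).comp hM
    rw [Matrix.det_one] at this
    exact this
  have hadj : Filter.Tendsto (fun k => (M k).adjugate) Filter.atTop (nhds 1) := by
    have hcont : Continuous fun A : Matrix n n ℝ => A.adjugate := continuous_id.matrix_adjugate
    have := (hcont.tendsto 1).comp hM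
    rw [Matrix.adjugate_one] at this
    exact this
  have hadjr : Filter.Tendsto (fun k => (M k).adjugate.mulVec (r k)) Filter.atTop (nhds 1) := by
    have hcont : Continuous fun p : Matrix n n ℝ × (n → ℝ) => p.1.mulVec p.2 :=
      continuous_fst.matrix_mulVec continuous_snd
    have h := (hcont.tendsto ((1 : Matrix n n ℝ), (1 : n → ℝ))).comp (hadj.prodMk_nhds hr)
    rw [Matrix.one_mulVec] at h
    exact h
  have hpos : ∀ᶠ k in Filter.atTop, ∀ v : n, 0 < (M k).adjugate.mulVec (r k) v := by
    refine Filter.eventually_all.2 fun v => ?_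
    have h1 := tendsto_pi_nhds.1 hadjr v
    exact h1.eventually (lt_mem_nhds one_pos)
  have hd0 : ∀ᶠ k in Filter.atTop, 0 < (M k).det := hdet.eventually (lt_mem_nhds one_pos)
  filter_upwards [hpos, hd0] with k h1 h2
  refine ⟨(M k).det⁻¹ • (M k).adjugate.mulVec (r k), fun v => ?_, ?_⟩
  · rw [Pi.smul_apply, smul_eq_mul]
    exact mul_pos (inv_pos.2 h2) (h1 v)
  · rw [Matrix.mulVec_smul, Matrix.mulVec_mulVec, Matrix.mul_adjugate, Matrix.smul_mulVec,
      Matrix.one_mulVec, smul_smul, inv_mul_cancel₀ h2.ne', one_smul]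

lemma aux_coef {d : ℕ} (V S : Finset (E d)) (hS : ∀ a ∈ S, ∀ v ∈ V, |⟪a, v⟫| < 1)
    (b : E d → E d) (hb1 : ∀ v ∈ V, ⟪b v, v⟫ = 1)
    (hb2 : ∀ v ∈ V, ∀ w ∈ V, w ≠ v → |⟪b v, w⟫| < 1) :
    ∃ k : ℕ, 1 ≤ k ∧ ∃ c : E d → ℝ, (∀ v ∈ V, 0 ≤ c v) ∧
      ∀ w ∈ V, ∑ a ∈ S, ⟪a, w⟫ ^ (2 * k) + ∑ v ∈ V, c v * ⟪b v, w⟫ ^ (2 * k) = 1 := by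
  classical
  have hpow : ∀ t : ℝ, |t| < 1 → Filter.Tendsto (fun k : ℕ => t ^ (2 * k)) Filter.atTop (nhds 0) := by
    intro t ht
    have h2 : |t ^ 2| < 1 := by
      rw [abs_pow]; exact pow_lt_one₀ (abs_nonneg _) ht two_ne_zero
    simpa [pow_mul] using tendsto_pow_atTop_nhds_zero_of_abs_lt_one h2
  let M : ℕ → Matrix V V ℝ := fun k => Matrix.of fun w v => ⟪b v, (w : E d)⟫ ^ (2 * k)
  let r : ℕ → V → ℝ := fun k w => 1 - ∑ a ∈ S, ⟪a, (w : E d)⟫ ^ (2 * k)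
  have hM : Filter.Tendsto M Filter.atTop (nhds 1) := by
    refine tendsto_pi_nhds.2 fun w => tendsto_pi_nhds.2 fun v => ?_
    by_cases h : w = v
    · subst h
      simp [M, hb1 w w.2]
    · rw [Matrix.one_apply_ne h]
      exact hpow _ (hb2 v v.2 w w.2 (fun h' => h (Subtype.ext h')))
  have hr : Filter.Tendsto r Filter.atTop (nhds 1) := by
    refine tendsto_pi_nhds.2 fun w => ?_
    have : Filter.Tendsto (fun k : ℕ => ∑ a ∈ S, ⟪a, (w : E d)⟫ ^ (2 * k)) Filter.atTop
        (nhds (∑ a ∈ S, (0 : ℝ))) := tendsto_finsetSum _ fun a ha => hpow _ (hS a ha w w.2)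
    simpa using this.const_sub 1
  obtain ⟨k, ⟨c0, hk1, hMc⟩, hk3⟩ := ((aux_lim M r hM hr).and (Filter.eventually_ge_atTop 1)).exists
  refine ⟨k, hk3, fun v => if h : v ∈ V then c0 ⟨v, h⟩ else 0, fun v hv => ?_, fun w hw => ?_⟩
  · simp only [hv, dif_pos]
    exact (hk1 _).le
  · have := congrFun hMc ⟨w, hw⟩
    simp only [Matrix.mulVec, dotProduct, M, Matrix.of_apply, r] at this
    rw [← Finset.sum_coe_sort V]
    simp only [Finset.coe_mem, dif_pos, Subtype.coe_eta]
    have h2 : ∑ v : V, c0 v * ⟪b v, w⟫ ^ (2 * k) = ∑ v : V, ⟪b v, w⟫ ^ (2 * k) * c0 v :=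
      Finset.sum_congr rfl fun _ _ => mul_comm _ _
    rw [h2, this]
    ring

lemma aux_S {d : ℕ} (u : E d) (V : Finset (E d)) (hV : ∀ w ∈ V, ⟪w, u⟫ = 1)
    (hne : V.Nonempty) (ε : ℝ) (hε : 0 < ε) :
    ∃ S : Finset (E d), (∀ a ∈ S, ∀ v ∈ V, |⟪a, v⟫| < 1) ∧
      (∀ x : E d, (∀ a ∈ S, ⟪a, x⟫ = 0) → x = 0) ∧
      ∀ x : E d, ⟪x, u⟫ = 1 → infDist x (convexHull ℝ (V : Set (E d))) = ε →
        ∃ a ∈ S, 1 < ⟪a, x⟫ := by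
  classical
  set P := convexHull ℝ (V : Set (E d)) with hPdef
  have hPc : IsCompact P := V.finite_toSet.isCompact_convexHull ℝ
  have hPne : P.Nonempty := hne.to_set.convexHull
  let K : Set (E d) := {x | ⟪x, u⟫ = 1 ∧ infDist x P = ε}
  have hK : IsCompact K := by
    have hKcl : IsClosed K := (isClosed_eq (by fun_prop) continuous_const).inter
      (isClosed_eq (continuous_infDist_pt P) continuous_const)
    refine (hPc.cthickening (r := ε)).of_isClosed_subset hKcl ?_
    intro x hx
    obtain ⟨y, hy, hxy⟩ := hPc.exists_infDist_eq_dist hPne x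
    exact mem_cthickening_of_dist_le x y ε P hy (hxy ▸ hx.2.le)
  have hsep : ∀ y : K, ∃ a : E d, (∀ w ∈ V, |⟪a, w⟫| < 1) ∧ 1 < ⟪a, (y : E d)⟫ := by
    rintro ⟨y, hy1, hy2⟩
    refine aux_sep u V hV y hy1 fun hyP => ?_
    have := infDist_zero_of_mem hyP
    rw [← hPdef] at this
    linarith
  choose a ha1 ha2 using hsep
  obtain ⟨t, ht⟩ := hK.elim_finite_subcover (fun y : K => {x : E d | 1 < ⟪a y, x⟫})
    (fun y => isOpen_lt continuous_const (by fun_prop))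
    (fun y hy => mem_iUnion.2 ⟨⟨y, hy⟩, ha2 ⟨y, hy⟩⟩)
  let N : ℝ := ∑ v ∈ V, ‖v‖
  have hN : 0 ≤ N := Finset.sum_nonneg fun _ _ => norm_nonneg _
  let e : Fin d → E d := fun i => (N + 1)⁻¹ • EuclideanSpace.single i (1 : ℝ)
  have he : ∀ i (x : E d), ⟪e i, x⟫ = (N + 1)⁻¹ * x i := by
    intro i x
    simp [e, real_inner_smul_left, EuclideanSpace.inner_single_left]
  refine ⟨t.image a ∪ Finset.univ.image e, ?_, ?_, ?_⟩
  · intro b hb v hv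
    rcases Finset.mem_union.1 hb with hb | hb
    · obtain ⟨y, _, rfl⟩ := Finset.mem_image.1 hb
      exact ha1 y v hv
    · obtain ⟨i, _, rfl⟩ := Finset.mem_image.1 hb
      rw [he, abs_mul, abs_of_pos (by positivity), inv_mul_lt_iff₀ (by positivity)]
      have h1 : ‖v i‖ ≤ ‖v‖ := PiLp.norm_apply_le v i
      have h2 : ‖v‖ ≤ N := Finset.single_le_sum (f := fun v : E d => ‖v‖) (fun _ _ => norm_nonneg _) hv
      rw [Real.norm_eq_abs] at h1
      linarith
  · intro x hx
    ext i
    have := hx (e i) (Finset.mem_union_right _ (Finset.mem_image_of_mem _ (Finset.mem_univ i)))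
    rw [he] at this
    have h3 : (N + 1)⁻¹ ≠ 0 := by positivity
    simpa [h3] using this
  · intro x hx1 hx2
    obtain ⟨y, hy, hxy⟩ := mem_iUnion₂.1 (ht ⟨hx1, hx2⟩)
    exact ⟨a y, Finset.mem_union_left _ (Finset.mem_image_of_mem _ hy), hxy⟩

/-- linear form as a polynomial -/
def linP {d : ℕ} (a : E d) : MvPolynomial (Fin d) ℝ := ∑ i, MvPolynomial.C (a i) * MvPolynomial.X i

lemma evalPoly_linP {d : ℕ} (a x : E d) : evalPoly (linP a) x = ⟪a, x⟫ := by
  simp [evalPoly, linP, PiLp.inner_apply, mul_comm]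

lemma linP_hom {d : ℕ} (a : E d) (n : ℕ) : (linP a ^ n).IsHomogeneous n := by
  have : (linP a).IsHomogeneous 1 := by
    refine MvPolynomial.IsHomogeneous.sum _ _ _ fun i _ => ?_
    simpa using (MvPolynomial.isHomogeneous_C (Fin d) (a i)).mul (MvPolynomial.isHomogeneous_X ℝ i)
  simpa using this.pow n

/-- the homogeneous polynomial -/
def gP {d : ℕ} (u : E d) (S V : Finset (E d)) (b : E d → E d) (c : E d → ℝ) (k : ℕ) :
    MvPolynomial (Fin d) ℝ :=
  linP u ^ (2 * k) - (∑ a ∈ S, linP a ^ (2 * k) +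
    ∑ v ∈ V, MvPolynomial.C (c v) * linP (b v) ^ (2 * k))

lemma evalPoly_gP {d : ℕ} (u : E d) (S V : Finset (E d)) (b : E d → E d) (c : E d → ℝ) (k : ℕ)
    (x : E d) : evalPoly (gP u S V b c k) x = ⟪x, u⟫ ^ (2 * k) -
      (∑ a ∈ S, ⟪a, x⟫ ^ (2 * k) + ∑ v ∈ V, c v * ⟪b v, x⟫ ^ (2 * k)) := by
  rw [real_inner_comm]
  simp only [← evalPoly_linP]
  simp [evalPoly, gP]

lemma gP_hom {d : ℕ} (u : E d) (S V : Finset (E d)) (b : E d → E d) (c : E d → ℝ) (k : ℕ) :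
    (gP u S V b c k).IsHomogeneous (2 * k) := by
  refine (linP_hom _ _).sub (MvPolynomial.IsHomogeneous.add
    (MvPolynomial.IsHomogeneous.sum _ _ _ fun i _ => linP_hom _ _)
    (MvPolynomial.IsHomogeneous.sum _ _ _ fun i _ => ?_))
  simpa using (MvPolynomial.isHomogeneous_C (Fin d) (c i)).mul (linP_hom (b i) (2 * k))

lemma evalPoly_smul {d : ℕ} {p : MvPolynomial (Fin d) ℝ} {n : ℕ} (hp : p.IsHomogeneous n)
    (t : ℝ) (x : E d) : evalPoly p (t • x) = t ^ n * evalPoly p x := by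
  simp only [evalPoly, MvPolynomial.eval_eq', Finset.mul_sum]
  refine Finset.sum_congr rfl fun m hm => ?_
  have h := hp (MvPolynomial.mem_support_iff.1 hm)
  have h2 : ∑ i, m i = n := by
    rw [← h, Finsupp.weight_apply, Finsupp.sum_fintype] <;> simp
  simp only [PiLp.smul_apply, smul_eq_mul, mul_pow, Finset.prod_mul_distrib,
    Finset.prod_pow_eq_pow_sum, h2]
  ring

lemma aux_convex {d : ℕ} (u : E d) (S V : Finset (E d)) (b : E d → E d) (c : E d → ℝ) (k : ℕ)
    (hk : 1 ≤ k) (hc : ∀ v ∈ V, 0 ≤ c v) (hS : ∀ x : E d, (∀ a ∈ S, ⟪a, x⟫ = 0) → x = 0) :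
    StrictConcaveOn ℝ {x : E d | ⟪x, u⟫ = 1} (evalPoly (gP u S V b c k)) := by
  have hev : Even (2 * k) := even_two_mul k
  have hcv : Convex ℝ {x : E d | ⟪x, u⟫ = 1} := by
    intro x hx y hy s t _ _ hst
    simp only [mem_ofPred_eq] at *
    rw [inner_add_left, real_inner_smul_left, real_inner_smul_left, hx, hy]
    linarith
  refine ⟨hcv, fun x hx y hy hxy s t hs ht hst => ?_⟩
  have hz := hcv hx hy hs.le ht.le hst
  simp only [mem_ofPred_eq] at hx hy hz
  simp only [evalPoly_gP, hz, hx, hy, one_pow, smul_eq_mul]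
  have hle : ∀ a : E d, ⟪a, s • x + t • y⟫ ^ (2 * k) ≤ s * ⟪a, x⟫ ^ (2 * k) + t * ⟪a, y⟫ ^ (2 * k) := by
    intro a
    have := hev.convexOn_pow (𝕜 := ℝ) |>.2 (mem_univ ⟪a, x⟫) (mem_univ ⟪a, y⟫) hs.le ht.le hst
    simpa [inner_add_right, real_inner_smul_right] using this
  have hlt : ∃ a ∈ S, ⟪a, s • x + t • y⟫ ^ (2 * k) < s * ⟪a, x⟫ ^ (2 * k) + t * ⟪a, y⟫ ^ (2 * k) := by
    by_contra! hcon
    apply hxy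
    rw [← sub_eq_zero]
    refine hS _ fun a ha => ?_
    rw [inner_sub_right, sub_eq_zero]
    by_contra hne
    have := (hev.strictConvexOn_pow (by omega)).2 (mem_univ ⟪a, x⟫) (mem_univ ⟪a, y⟫) hne hs ht hst
    have h2 := hcon a ha
    simp only [inner_add_right, real_inner_smul_right, smul_eq_mul] at this h2
    linarith
  have h1 : ∑ a ∈ S, ⟪a, s • x + t • y⟫ ^ (2 * k) <
      s * ∑ a ∈ S, ⟪a, x⟫ ^ (2 * k) + t * ∑ a ∈ S, ⟪a, y⟫ ^ (2 * k) := by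
    rw [Finset.mul_sum, Finset.mul_sum, ← Finset.sum_add_distrib]
    exact Finset.sum_lt_sum (fun a _ => hle a) hlt
  have h2 : ∑ v ∈ V, c v * ⟪b v, s • x + t • y⟫ ^ (2 * k) ≤
      s * ∑ v ∈ V, c v * ⟪b v, x⟫ ^ (2 * k) + t * ∑ v ∈ V, c v * ⟪b v, y⟫ ^ (2 * k) := by
    rw [Finset.mul_sum, Finset.mul_sum, ← Finset.sum_add_distrib]
    refine Finset.sum_le_sum fun v hv => ?_
    have := mul_le_mul_of_nonneg_left (hle (b v)) (hc v hv)
    linarith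
  linarith

lemma aux_cone {d : ℕ} (u : E d) (p : MvPolynomial (Fin d) ℝ) (k : ℕ) (hk : 1 ≤ k)
    (hp : p.IsHomogeneous (2 * k)) (hconc : StrictConcaveOn ℝ {x : E d | ⟪x, u⟫ = 1} (evalPoly p))
    (hneg : ∀ x : E d, ⟪x, u⟫ = 0 → 0 ≤ evalPoly p x → x = 0) :
    {x : E d | 0 ≤ evalPoly p x ∧ 0 ≤ ⟪x, u⟫} =
      coneHull {x ∈ {x : E d | ⟪x, u⟫ = 1} | 0 ≤ evalPoly p x} := by
  have hev : Even (2 * k) := even_two_mul k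
  ext x
  constructor
  · rintro ⟨h1, h2⟩
    rcases h2.eq_or_lt with h0 | hpos
    · have := hneg x h0.symm h1
      exact ⟨0, Fin.elim0, Fin.elim0, fun i => i.elim0, fun i => i.elim0, by simp [this]⟩
    · refine ⟨1, fun _ => ⟪x, u⟫, fun _ => ⟪x, u⟫⁻¹ • x, fun _ => h2, fun _ => ⟨?_, ?_⟩, ?_⟩
      · simp [real_inner_smul_left, hpos.ne']
      · rw [evalPoly_smul hp]
        exact mul_nonneg (hev.pow_nonneg _) h1
      · simp [smul_smul, hpos.ne']
  · rintro ⟨n, c, q, hc, hq, rfl⟩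
    have hA : Convex ℝ {x ∈ {x : E d | ⟪x, u⟫ = 1} | 0 ≤ evalPoly p x} := hconc.concaveOn.convex_ge 0
    have hin : ⟪∑ i, c i • q i, u⟫ = ∑ i, c i := by
      rw [sum_inner]
      refine Finset.sum_congr rfl fun i _ => ?_
      rw [real_inner_smul_left, (hq i).1, mul_one]
    have hcs : 0 ≤ ∑ i, c i := Finset.sum_nonneg fun i _ => hc i
    refine ⟨?_, by rw [hin]; exact hcs⟩
    rcases hcs.eq_or_lt with h0 | hpos
    · have hz : ∀ i, c i = 0 := fun i =>
        (Finset.sum_eq_zero_iff_of_nonneg fun i _ => hc i).1 h0.symm i (Finset.mem_univ i)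
      have : ∑ i, c i • q i = (0 : ℝ) • (0 : E d) := by simp [hz]
      rw [this, evalPoly_smul hp, zero_pow (by omega), zero_mul]
    · have hm := hA.centerMass_mem (t := Finset.univ) (w := c) (z := q) (fun i _ => hc i) hpos
        (fun i _ => hq i)
      have : ∑ i, c i • q i = (∑ i, c i) • Finset.univ.centerMass c q := by
        simp [Finset.centerMass, smul_smul, hpos.ne']
      rw [this, evalPoly_smul hp]
      exact mul_nonneg (hev.pow_nonneg _) hm.2

lemma aux_main {d : ℕ} (P : Set (E d)) (hP : IsPolytope P) (u : E d)
    (hu : (affineSpan ℝ P : Set (E d)) = {x : E d | ⟪x, u⟫ = 1}) (ε : ℝ) (hε : 0 < ε) :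
    ∃ g : MvPolynomial (Fin d) ℝ,
      hausdorffDist P {x ∈ (affineSpan ℝ P : Set (E d)) | 0 ≤ evalPoly g x} ≤ ε ∧
      (∀ v, IsVertexOf P v → evalPoly g v = 0) ∧
      StrictConcaveOn ℝ (affineSpan ℝ P : Set (E d)) (evalPoly g) ∧
      IsHomContinuation u g g ∧
        {x : E d | 0 ≤ evalPoly g x ∧ 0 ≤ ⟪x, u⟫} =
          coneHull {x ∈ (affineSpan ℝ P : Set (E d)) | 0 ≤ evalPoly g x} := by
  classical
  obtain ⟨V0, hV0, hPV0⟩ := hP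
  have hPc : IsCompact P := hPV0 ▸ V0.finite_toSet.isCompact_convexHull ℝ
  have hPcv : Convex ℝ P := hPV0 ▸ convex_convexHull ℝ _
  have hPne : P.Nonempty := hPV0 ▸ hV0.to_set.convexHull
  have hfin : (P.extremePoints ℝ).Finite :=
    V0.finite_toSet.subset (hPV0 ▸ extremePoints_convexHull_subset)
  let V : Finset (E d) := hfin.toFinset
  have hVc : (V : Set (E d)) = P.extremePoints ℝ := hfin.coe_toFinset
  have hPV : P = convexHull ℝ (V : Set (E d)) := by
    have h := closure_convexHull_extremePoints hPc hPcv
    rw [(hfin.isClosed_convexHull ℝ).closure_eq] at h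
    rw [hVc, h]
  have hVP : ∀ v ∈ V, v ∈ P := fun v hv => hPV ▸ subset_convexHull ℝ _ hv
  have hPH : ∀ x ∈ P, ⟪x, u⟫ = 1 := fun x hx => by
    have : x ∈ (affineSpan ℝ P : Set (E d)) := subset_affineSpan ℝ P hx
    rwa [hu] at this
  have hVH : ∀ v ∈ V, ⟪v, u⟫ = 1 := fun v hv => hPH v (hVP v hv)
  have hVne : V.Nonempty := by
    rw [← Finset.coe_nonempty, ← convexHull_nonempty_iff (𝕜 := ℝ), ← hPV]; exact hPne
  have hind : ∀ v ∈ V, v ∉ convexHull ℝ ((V.erase v : Finset (E d)) : Set (E d)) := by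
    intro v hv hcon
    have := (convexIndependent_set_iff_notMem_convexHull_sdiff.1
      hPcv.convexIndependent_extremePoints) v (hVc ▸ hv)
    rw [← hVc] at this
    simp only [Finset.coe_erase] at hcon
    exact this hcon
  have hb : ∀ v : E d, ∃ b : E d, v ∈ V → ⟪b, v⟫ = 1 ∧ ∀ w ∈ V, w ≠ v → |⟪b, w⟫| < 1 := by
    intro v
    by_cases hv : v ∈ V
    · obtain ⟨a, ha1, ha2⟩ := aux_sep u (V.erase v) (fun w hw => hVH w (Finset.mem_of_mem_erase hw))
        v (hVH v hv) (hind v hv)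
      have hpos : 0 < ⟪a, v⟫ := by linarith
      refine ⟨⟪a, v⟫⁻¹ • a, fun _ => ⟨?_, fun w hw hwv => ?_⟩⟩
      · rw [real_inner_smul_left, inv_mul_cancel₀ hpos.ne']
      · have := ha1 w (Finset.mem_erase.2 ⟨hwv, hw⟩)
        rw [real_inner_smul_left, abs_mul, abs_of_pos (by positivity), inv_mul_lt_iff₀ hpos]
        linarith
    · exact ⟨0, fun h => absurd h hv⟩
  choose b hb using hb
  obtain ⟨S, hS1, hS2, hS3⟩ := aux_S u V hVH hVne ε hε
  rw [← hPV] at hS3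
  obtain ⟨k, hk, c, hc, hsum⟩ := aux_coef V S hS1 b (fun v hv => (hb v hv).1) (fun v hv => (hb v hv).2)
  have hev : Even (2 * k) := even_two_mul k
  have hconc := aux_convex u S V b c k hk hc hS2
  have hhom := gP_hom u S V b c k
  have hVz : ∀ v ∈ V, evalPoly (gP u S V b c k) v = 0 := by
    intro v hv
    rw [evalPoly_gP, hsum v hv, hVH v hv, one_pow, sub_self]
  have hc2 : ∀ x : E d, 0 ≤ ∑ v ∈ V, c v * ⟪b v, x⟫ ^ (2 * k) := fun x =>
    Finset.sum_nonneg fun v hv => mul_nonneg (hc v hv) (hev.pow_nonneg _)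
  refine ⟨gP u S V b c k, ?_, ?_, ?_, ?_, ?_⟩
  · rw [hu]
    set A := {x ∈ {x : E d | ⟪x, u⟫ = 1} | 0 ≤ evalPoly (gP u S V b c k) x} with hA
    have hAcv : Convex ℝ A := hconc.concaveOn.convex_ge 0
    have hPA : P ⊆ A := by
      rw [hPV]
      exact convexHull_min (fun v hv => ⟨hVH v hv, (hVz v hv).ge⟩) hAcv
    refine hausdorffDist_le_of_infDist hε.le (fun x hx => ?_) (fun x hx => ?_)
    · rw [infDist_zero_of_mem (hPA hx)]; exact hε.le
    · by_contra! hlt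
      obtain ⟨p, hp⟩ := hPne
      have hivt := hAcv.isPreconnected.intermediate_value (hPA hp) hx
        (continuous_infDist_pt P).continuousOn
      rw [infDist_zero_of_mem hp] at hivt
      obtain ⟨z, hzA, hz⟩ := hivt ⟨hε.le, hlt.le⟩
      obtain ⟨a, haS, ha⟩ := hS3 z hzA.1 hz
      have h1 := hzA.2
      rw [evalPoly_gP, hzA.1, one_pow] at h1
      have h2 := hc2 z
      have h3 : ⟪a, z⟫ ^ (2 * k) ≤ ∑ a ∈ S, ⟪a, z⟫ ^ (2 * k) :=
        Finset.single_le_sum (f := fun a => ⟪a, z⟫ ^ (2 * k)) (fun a _ => hev.pow_nonneg _) haS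
      have h4 : 1 < ⟪a, z⟫ ^ (2 * k) := one_lt_pow₀ ha (by omega)
      linarith
  · intro v hv
    apply hVz
    rw [← Finset.mem_coe, hVc]
    exact hv.isExtreme.mem_extremePoints
  · rw [hu]; exact hconc
  · by_cases h0 : gP u S V b c k = 0
    · rw [h0]
      exact ⟨MvPolynomial.isHomogeneous_zero _ _ _, fun x _ => by simp [evalPoly]⟩
    · have := hhom.totalDegree h0
      refine ⟨by rw [this]; exact hhom, fun x hx => ?_⟩
      rw [this, evalPoly_smul hhom, ← mul_assoc, ← mul_pow, mul_inv_cancel₀ hx, one_pow, one_mul]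
  · rw [hu]
    refine aux_cone u _ k hk hhom hconc fun x hx hx0 => hS2 x fun a ha => ?_
    rw [evalPoly_gP, hx, zero_pow (by omega)] at hx0
    have h2 := hc2 x
    have h3 : ⟪a, x⟫ ^ (2 * k) ≤ ∑ a ∈ S, ⟪a, x⟫ ^ (2 * k) :=
      Finset.single_le_sum (f := fun a => ⟪a, x⟫ ^ (2 * k)) (fun a _ => hev.pow_nonneg _) ha
    have h4 : 0 ≤ ⟪a, x⟫ ^ (2 * k) := hev.pow_nonneg _
    exact pow_eq_zero_iff (n := 2 * k) (by omega) |>.1 (by linarith)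

/-- For a (d−1)-dimensional polytope P in ℝ^d with o ∉ aff P there is a
sequence of polynomials satisfying 𝒜(P), ℐ(P), 𝒞(P) and ℋ(P). -/
theorem exists_seq_AICH {d : ℕ} (P : Set (E d)) (hP : IsPolytope P)
    (hdim : dimS P + 1 = d)
    (u : E d) (hu : (affineSpan ℝ P : Set (E d)) = {x : E d | ⟪x, u⟫ = 1}) :
    ∃ g : ℕ → MvPolynomial (Fin d) ℝ, condA P g ∧ condI P g ∧ condC P g ∧
      ∀ l : ℕ, ∃ gt : MvPolynomial (Fin d) ℝ, IsHomContinuation u (g l) gt ∧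
        {x : E d | 0 ≤ evalPoly gt x ∧ 0 ≤ ⟪x, u⟫} =
          coneHull {x ∈ (affineSpan ℝ P : Set (E d)) | 0 ≤ evalPoly (g l) x} := by
  choose g hA hI hC hH1 hH2 using fun l : ℕ =>
    aux_main P hP u hu (1 / ((l : ℝ) + 1)) Nat.one_div_pos_of_nat
  refine ⟨g, ?_, fun l v hv => hI l v hv, hC, fun l => ⟨g l, hH1 l, hH2 l⟩⟩
  exact squeeze_zero (fun _ => hausdorffDist_nonneg) hA tendsto_one_div_add_atTop_nhds_zero_nat
end
end
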